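/- Let G be a unicyclic graph with at least two branch-active vertices, i.e. b(G) ≥ 2. Then edim(G) = L(G) + Δ_e, where Δ_e = 0 if G contains none of the configurations A, D, E with respect to a smallest branch-resolving set (equivalently, with respect to every smallest branch-resolving set), and Δ_e = 1 otherwise. -/

import Mathlib

open SimpleGraph

section Defs

variable {V : Type*}

/-- Distance from a vertex `s` to an edge `e`: the minimum of the distances to its endpoints. -/
noncomputable def edgeDist (G : SimpleGraph V) (s : V) (e : Sym2 V) : ℕ :=
  Sym2.lift ⟨fun u w => min (G.dist s u) (G.dist s w), fun u w => min_comm _ _⟩ e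

/-- `S` is a vertex metric generator of `G`. -/
def IsVertexMG (G : SimpleGraph V) (S : Set V) : Prop :=
  ∀ u v : V, u ≠ v → ∃ s ∈ S, G.dist s u ≠ G.dist s v

/-- `S` is an edge metric generator of `G`. -/
def IsEdgeMG (G : SimpleGraph V) (S : Set V) : Prop :=
  ∀ e ∈ G.edgeSet, ∀ f ∈ G.edgeSet, e ≠ f → ∃ s ∈ S, edgeDist G s e ≠ edgeDist G s f

/-- The vertex metric dimension of `G`. -/
noncomputable def metricDim (G : SimpleGraph V) : ℕ :=
  sInf {n | ∃ S : Finset V, S.card = n ∧ IsVertexMG G ↑S}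

/-- The edge metric dimension of `G`. -/
noncomputable def edgeMetricDim (G : SimpleGraph V) : ℕ :=
  sInf {n | ∃ S : Finset V, S.card = n ∧ IsEdgeMG G ↑S}

/-- `G` is unicyclic: connected, contains a cycle, and any two cycles have the same edges. -/
def IsUnicyclic (G : SimpleGraph V) : Prop :=
  G.Connected ∧ (∃ (u : V) (w : G.Walk u u), w.IsCycle) ∧
    ∀ (u u' : V) (w : G.Walk u u) (w' : G.Walk u' u'), w.IsCycle → w'.IsCycle →
      ∀ e, e ∈ w.edges ↔ e ∈ w'.edges

/-- `vc : ZMod g → V` is a labelling `v_0 v_1 ⋯ v_{g-1}` of a cycle of length `g` in `G`. -/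
def IsCycleLabelling (G : SimpleGraph V) (g : ℕ) (vc : ZMod g → V) : Prop :=
  Function.Injective vc ∧ ∀ i : ZMod g, G.Adj (vc i) (vc (i + 1))

/-- The set of edges of the cycle `C`. -/
def cycleEdges (g : ℕ) (vc : ZMod g → V) : Set (Sym2 V) :=
  {e | ∃ i : ZMod g, e = s(vc i, vc (i + 1))}

/-- The graph `G - E(C)`. -/
def offCycle (G : SimpleGraph V) (g : ℕ) (vc : ZMod g → V) : SimpleGraph V :=
  G.deleteEdges (cycleEdges g vc)

/-- `x` belongs to `T_{v_i}`, the connected component of `G - E(C)` containing `v_i`. -/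
def inTree (G : SimpleGraph V) (g : ℕ) (vc : ZMod g → V) (i : ZMod g) (x : V) : Prop :=
  (offCycle G g vc).Reachable (vc i) x

/-- The vertex `v_i` of the cycle is `S`-active: `T_{v_i}` contains a vertex of `S`. -/
def SActive (G : SimpleGraph V) (g : ℕ) (vc : ZMod g → V) (S : Set V) (i : ZMod g) : Prop :=
  ∃ s ∈ S, inTree G g vc i s

/-- `a_S(C)`: the number of `S`-active vertices on the cycle. -/
noncomputable def aS (G : SimpleGraph V) (g : ℕ) (vc : ZMod g → V) (S : Set V) : ℕ :=
  {i : ZMod g | SActive G g vc S i}.ncard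

/-- `S` is biactive: `a_S(C) ≥ 2`. -/
def Biactive (G : SimpleGraph V) (g : ℕ) (vc : ZMod g → V) (S : Set V) : Prop :=
  2 ≤ aS G g vc S

variable [Fintype V] [DecidableEq V]

/-- `t = u_1 u_2 ⋯ u_k` is a thread hanging at the vertex `v`. -/
def IsThreadAt (G : SimpleGraph V) [DecidableRel G.Adj] (v : V) (t : List V) : Prop :=
  t ≠ [] ∧ t.Nodup ∧ v ∉ t ∧ 3 ≤ G.degree v ∧ List.Chain' G.Adj t ∧
    (∀ u ∈ t.head?, G.Adj v u) ∧ (∀ u ∈ t.getLast?, G.degree u = 1) ∧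
    ∀ u ∈ t.dropLast, G.degree u = 2

/-- The thread `t` is `S`-free: it contains no vertex of `S`. -/
def SFree (S : Set V) (t : List V) : Prop := ∀ u ∈ t, u ∉ S

/-- `S` is branch-resolving: for every vertex, all threads hanging at it except possibly
one contain a vertex of `S` (i.e. at most one thread at each vertex is `S`-free). -/
def BranchResolving (G : SimpleGraph V) [DecidableRel G.Adj] (S : Set V) : Prop :=
  ∀ v : V, ∀ t₁ t₂ : List V, IsThreadAt G v t₁ → IsThreadAt G v t₂ → t₁ ≠ t₂ →
    (∃ s ∈ S, s ∈ t₁) ∨ (∃ s ∈ S, s ∈ t₂)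

/-- `ℓ(v)`: the number of threads hanging at `v`. -/
noncomputable def numThreads (G : SimpleGraph V) [DecidableRel G.Adj] (v : V) : ℕ :=
  {t : List V | IsThreadAt G v t}.ncard

/-- `L(G) = Σ (ℓ(v) - 1)` (truncated subtraction makes the sum run exactly over the
vertices with `ℓ(v) > 1`). -/
noncomputable def LG (G : SimpleGraph V) [DecidableRel G.Adj] : ℕ :=
  ∑ v : V, (numThreads G v - 1)

/-- `x` is a branching vertex of the unicyclic graph with cycle `vc`. -/
def Branching (G : SimpleGraph V) [DecidableRel G.Adj] (g : ℕ) (vc : ZMod g → V) (x : V) :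
    Prop :=
  (x ∉ Set.range vc ∧ 3 ≤ G.degree x) ∨ (x ∈ Set.range vc ∧ 4 ≤ G.degree x)

/-- The cycle vertex `v_i` is branch-active: `T_{v_i}` contains a branching vertex. -/
def BranchActive (G : SimpleGraph V) [DecidableRel G.Adj] (g : ℕ) (vc : ZMod g → V)
    (i : ZMod g) : Prop :=
  ∃ x, inTree G g vc i x ∧ Branching G g vc x

/-- `b(G)`: the number of branch-active vertices on the cycle. -/
noncomputable def bG (G : SimpleGraph V) [DecidableRel G.Adj] (g : ℕ) (vc : ZMod g → V) : ℕ :=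
  {i : ZMod g | BranchActive G g vc i}.ncard

/-- `k = max { i : v_i is S-active }` for the labelling `vc` (indices taken in `[0, g-1]`). -/
noncomputable def kOf (G : SimpleGraph V) (g : ℕ) (vc : ZMod g → V) (S : Set V) : ℕ :=
  sSup {n : ℕ | n < g ∧ SActive G g vc S (n : ZMod g)}

/-- The labelling `vc` of the cycle is canonical with respect to `S`: `v_0` is `S`-active
and `k` is as small as possible among all labellings of the cycle with `v_0` `S`-active. -/
def Canonical (G : SimpleGraph V) (g : ℕ) (vc : ZMod g → V) (S : Set V) : Prop :=
  IsCycleLabelling G g vc ∧ SActive G g vc S 0 ∧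
    ∀ vc' : ZMod g → V, IsCycleLabelling G g vc' → Set.range vc' = Set.range vc →
      SActive G g vc' S 0 → kOf G g vc S ≤ kOf G g vc' S

/-- Configuration 𝒜 : `a_S(C) = 2`, `g` even and `k = g/2`. -/
def ConfigA (G : SimpleGraph V) (g : ℕ) (vc : ZMod g → V) (S : Set V) : Prop :=
  aS G g vc S = 2 ∧ Even g ∧ kOf G g vc S = g / 2

/-- Configuration ℬ : `k ≤ ⌊g/2⌋ - 1` and an `S`-free thread hangs at `v_i` for some
`i ∈ [k, ⌊g/2⌋-1] ∪ [⌈g/2⌉+k+1, g-1] ∪ {0}`. -/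
def ConfigB (G : SimpleGraph V) [DecidableRel G.Adj] (g : ℕ) (vc : ZMod g → V) (S : Set V) :
    Prop :=
  kOf G g vc S ≤ g / 2 - 1 ∧
    ∃ i : ℕ, ((kOf G g vc S ≤ i ∧ i ≤ g / 2 - 1) ∨
        ((g + 1) / 2 + kOf G g vc S + 1 ≤ i ∧ i ≤ g - 1) ∨ i = 0) ∧
      ∃ t : List V, IsThreadAt G (vc (i : ZMod g)) t ∧ SFree S t

/-- Configuration 𝒞 : `a_S(C) = 2`, `g` even, `k ≤ g/2` and an `S`-free thread of length
`≥ g/2 - k` hangs at `v_i` for some `i ∈ [0, k]`. -/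
def ConfigC (G : SimpleGraph V) [DecidableRel G.Adj] (g : ℕ) (vc : ZMod g → V) (S : Set V) :
    Prop :=
  aS G g vc S = 2 ∧ Even g ∧ kOf G g vc S ≤ g / 2 ∧
    ∃ i : ℕ, i ≤ kOf G g vc S ∧
      ∃ t : List V, IsThreadAt G (vc (i : ZMod g)) t ∧ SFree S t ∧
        g / 2 - kOf G g vc S ≤ t.length

/-- Configuration 𝒟 : `k ≤ ⌈g/2⌉ - 1` and an `S`-free thread hangs at `v_i` for some
`i ∈ [k, ⌈g/2⌉-1] ∪ [⌊g/2⌋+k+1, g-1] ∪ {0}`. -/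
def ConfigD (G : SimpleGraph V) [DecidableRel G.Adj] (g : ℕ) (vc : ZMod g → V) (S : Set V) :
    Prop :=
  kOf G g vc S ≤ (g + 1) / 2 - 1 ∧
    ∃ i : ℕ, ((kOf G g vc S ≤ i ∧ i ≤ (g + 1) / 2 - 1) ∨
        (g / 2 + kOf G g vc S + 1 ≤ i ∧ i ≤ g - 1) ∨ i = 0) ∧
      ∃ t : List V, IsThreadAt G (vc (i : ZMod g)) t ∧ SFree S t

/-- Configuration ℰ : `a_S(C) = 2` and an `S`-free thread of length `≥ ⌊g/2⌋ - k + 1`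
hangs at `v_i` with `i ∈ [0, k]`; moreover if `g` is even an `S`-free thread hangs at
`v_j` with `j = g/2 + k - i`. -/
def ConfigE (G : SimpleGraph V) [DecidableRel G.Adj] (g : ℕ) (vc : ZMod g → V) (S : Set V) :
    Prop :=
  aS G g vc S = 2 ∧
    ∃ i : ℕ, i ≤ kOf G g vc S ∧
      (∃ t : List V, IsThreadAt G (vc (i : ZMod g)) t ∧ SFree S t ∧
        g / 2 - kOf G g vc S + 1 ≤ t.length) ∧
      (Even g → ∃ t' : List V,
        IsThreadAt G (vc ((g / 2 + kOf G g vc S - i : ℕ) : ZMod g)) t' ∧ SFree S t')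

/-- `G` contains configuration 𝒜 with respect to `S` (evaluated on a canonical labelling
of the cycle given by `vc`). -/
def ContainsA (G : SimpleGraph V) (g : ℕ) (vc : ZMod g → V) (S : Set V) : Prop :=
  ∃ vc' : ZMod g → V, IsCycleLabelling G g vc' ∧ Set.range vc' = Set.range vc ∧
    Canonical G g vc' S ∧ ConfigA G g vc' S

/-- `G` contains configuration ℬ with respect to `S`. -/
def ContainsB (G : SimpleGraph V) [DecidableRel G.Adj] (g : ℕ) (vc : ZMod g → V)
    (S : Set V) : Prop :=
  ∃ vc' : ZMod g → V, IsCycleLabelling G g vc' ∧ Set.range vc' = Set.range vc ∧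
    Canonical G g vc' S ∧ ConfigB G g vc' S

/-- `G` contains configuration 𝒞 with respect to `S`. -/
def ContainsC (G : SimpleGraph V) [DecidableRel G.Adj] (g : ℕ) (vc : ZMod g → V)
    (S : Set V) : Prop :=
  ∃ vc' : ZMod g → V, IsCycleLabelling G g vc' ∧ Set.range vc' = Set.range vc ∧
    Canonical G g vc' S ∧ ConfigC G g vc' S

/-- `G` contains configuration 𝒟 with respect to `S`. -/
def ContainsD (G : SimpleGraph V) [DecidableRel G.Adj] (g : ℕ) (vc : ZMod g → V)
    (S : Set V) : Prop :=
  ∃ vc' : ZMod g → V, IsCycleLabelling G g vc' ∧ Set.range vc' = Set.range vc ∧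
    Canonical G g vc' S ∧ ConfigD G g vc' S

/-- `G` contains configuration ℰ with respect to `S`. -/
def ContainsE (G : SimpleGraph V) [DecidableRel G.Adj] (g : ℕ) (vc : ZMod g → V)
    (S : Set V) : Prop :=
  ∃ vc' : ZMod g → V, IsCycleLabelling G g vc' ∧ Set.range vc' = Set.range vc ∧
    Canonical G g vc' S ∧ ConfigE G g vc' S

/-- `G` contains one of the configurations 𝒜, ℬ, 𝒞 with respect to `S`. -/
def ContainsABC (G : SimpleGraph V) [DecidableRel G.Adj] (g : ℕ) (vc : ZMod g → V)
    (S : Set V) : Prop :=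
  ContainsA G g vc S ∨ ContainsB G g vc S ∨ ContainsC G g vc S

/-- `G` contains one of the configurations 𝒜, 𝒟, ℰ with respect to `S`. -/
def ContainsADE (G : SimpleGraph V) [DecidableRel G.Adj] (g : ℕ) (vc : ZMod g → V)
    (S : Set V) : Prop :=
  ContainsA G g vc S ∨ ContainsD G g vc S ∨ ContainsE G g vc S

/-- `S` is a smallest branch-resolving set of `G`. -/
def SmallestBR (G : SimpleGraph V) [DecidableRel G.Adj] (S : Finset V) : Prop :=
  BranchResolving G ↑S ∧ ∀ S' : Finset V, BranchResolving G ↑S' → S.card ≤ S'.card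

/-- `S` is a smallest biactive branch-resolving set of `G`. -/
def SmallestBBR (G : SimpleGraph V) [DecidableRel G.Adj] (g : ℕ) (vc : ZMod g → V)
    (S : Finset V) : Prop :=
  BranchResolving G ↑S ∧ Biactive G g vc ↑S ∧
    ∀ S' : Finset V, BranchResolving G ↑S' → Biactive G g vc ↑S' → S.card ≤ S'.card

/-- `G` is 𝒜ℬ𝒞-negative. -/
def ABCneg (G : SimpleGraph V) [DecidableRel G.Adj] (g : ℕ) (vc : ZMod g → V) : Prop :=
  ∃ S : Finset V, SmallestBBR G g vc S ∧ ¬ ContainsABC G g vc ↑S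

/-- `G` is 𝒜𝒟ℰ-negative. -/
def ADEneg (G : SimpleGraph V) [DecidableRel G.Adj] (g : ℕ) (vc : ZMod g → V) : Prop :=
  ∃ S : Finset V, SmallestBBR G g vc S ∧ ¬ ContainsADE G g vc ↑S

end Defs

/-- A unicyclic graph rooted at its cycle: every vertex has a height above the cycle, a foot on
the cycle and, off the cycle, a parent; parent edges and cycle edges are the only edges. -/
structure CycleRooting {V : Type*} (G : SimpleGraph V) (g : ℕ) (vc : ZMod g → V) where
  height : V → ℕ
  foot : V → ZMod g
  parent : V → V
  height_vc : ∀ i, height (vc i) = 0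
  foot_vc : ∀ i, foot (vc i) = i
  vc_foot : ∀ x, height x = 0 → vc (foot x) = x
  adj_parent : ∀ x, 0 < height x → G.Adj (parent x) x
  height_parent : ∀ x, 0 < height x → height (parent x) + 1 = height x
  foot_parent : ∀ x, 0 < height x → foot (parent x) = foot x
  adj_vc : ∀ i, G.Adj (vc i) (vc (i + 1))
  adj_cases : ∀ x y, G.Adj x y → (0 < height x ∧ parent x = y) ∨ (0 < height y ∧ parent y = x) ∨
    (height x = 0 ∧ height y = 0 ∧ (foot y = foot x + 1 ∨ foot x = foot y + 1))

section Rooting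

variable {V : Type*} {G : SimpleGraph V} {g : ℕ} {vc : ZMod g → V}

lemma natCast_zmod_inj {a b : ℕ} (ha : a < g) (hb : b < g)
    (h : (a : ZMod g) = b) : a = b := by
  rw [ZMod.natCast_eq_natCast_iff] at h
  rwa [Nat.ModEq, Nat.mod_eq_of_lt ha, Nat.mod_eq_of_lt hb] at h

lemma cycleEdge_ne_first (hg : 3 ≤ g) (hvc : IsCycleLabelling G g vc) {n : ℕ} (hn : 0 < n)
    (hng : n < g) : s(vc n, vc ((n : ZMod g) + 1)) ≠ s(vc 0, vc 1) := by
  intro h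
  rw [Sym2.eq_iff] at h
  rcases h with ⟨h, -⟩ | ⟨h, h'⟩
  · have := natCast_zmod_inj (b := 0) hng (by omega) (by simpa using hvc.1 h)
    omega
  · have h1 : n = 1 := natCast_zmod_inj (b := 1) hng (by omega) (by simpa using hvc.1 h)
    have h2 := hvc.1 h'
    subst h1
    have := natCast_zmod_inj (g := g) (a := 2) (b := 0) (by omega) (by omega)
      (by push_cast at h2 ⊢; rw [← h2]; norm_num)
    omega

lemma reachable_along_cycle (hg : 3 ≤ g) (hvc : IsCycleLabelling G g vc) (B : Set (Sym2 V))
    (hB : ∀ i, s(vc i, vc (i + 1)) ∈ B → s(vc i, vc (i + 1)) = s(vc 0, vc 1)) (i : ZMod g) :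
    (G.deleteEdges B).Reachable (vc 1) (vc i) := by
  have key : ∀ n : ℕ, n < g → (G.deleteEdges B).Reachable (vc 1) (vc ((n + 1 : ℕ) : ZMod g)) := by
    intro n
    induction n with
    | zero => intro _; simp
    | succ n ih =>
      intro h
      refine (ih (by omega)).trans (Adj.reachable ?_)
      rw [deleteEdges_adj]
      have e : (((n + 1 + 1 : ℕ) : ZMod g)) = ((n + 1 : ℕ) : ZMod g) + 1 := by push_cast; ring
      rw [e]
      exact ⟨hvc.2 _, fun hm => cycleEdge_ne_first hg hvc (Nat.succ_pos n) h (hB _ hm)⟩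
  have : NeZero g := ⟨by omega⟩
  have h := key (i - 1).val (ZMod.val_lt _)
  rwa [Nat.cast_succ, ZMod.natCast_zmod_val, sub_add_cancel] at h

lemma isAcyclic_deleteEdges_first (hG : IsUnicyclic G) (hg : 3 ≤ g)
    (hvc : IsCycleLabelling G g vc) : (G.deleteEdges {s(vc 0, vc 1)}).IsAcyclic := by
  intro u w hw
  have hbr : G.IsBridge s(vc 0, vc 1) := by
    rw [isBridge_iff_forall_cycle_notMem (by simpa using hvc.2 0)]
    intro u' p hp hmem
    rw [← hG.2.2 u u' _ _ (hw.mapLe (deleteEdges_le _)) hp, Walk.edges_mapLe_eq_edges] at hmem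
    have := w.edges_subset_edgeSet hmem
    simp at this
  rw [isBridge_iff] at hbr
  refine hbr (reachable_along_cycle hg hvc _ (fun i hi => hi) 0).symm

theorem exists_cycleRooting [Fintype V] (hG : IsUnicyclic G) (hg : 3 ≤ g)
    (hvc : IsCycleLabelling G g vc) : Nonempty (CycleRooting G g vc) := by
  have : NeZero g := ⟨by omega⟩
  have hmin : ∀ x, ∃ i, ∀ j, G.dist x (vc i) ≤ G.dist x (vc j) := fun x =>
    Finite.exists_min fun i => G.dist x (vc i)
  choose m hm using hmin
  obtain ⟨height, hheight⟩ : ∃ f : V → ℕ, ∀ x, f x = G.dist x (vc (m x)) := ⟨_, fun _ => rfl⟩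
  have hpar : ∀ x, ∃ y, 0 < height x → G.Adj y x ∧ height y + 1 = height x := by
    intro x
    by_cases h0 : 0 < height x
    · obtain ⟨p, hp⟩ := hG.1.exists_walk_length_eq_dist x (vc (m x))
      rw [← hheight] at hp
      generalize hz : vc (m x) = z at p
      cases p with
      | nil => rw [← hp] at h0; simp at h0
      | @cons _ y _ hxy q =>
        refine ⟨y, fun _ => ⟨hxy.symm, ?_⟩⟩
        rw [Walk.length_cons] at hp
        subst hz
        have h1 := (hm y (m x)).trans (dist_le q)
        have h2 := hm x (m y)
        have h3 := hG.1.dist_triangle (u := x) (v := y) (w := vc (m y))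
        rw [dist_eq_one_iff_adj.2 hxy] at h3
        rw [← hheight] at h1 h2 h3
        omega
    · exact ⟨x, fun h => absurd h h0⟩
  choose parent hparent using hpar
  have height_vc : ∀ i, height (vc i) = 0 := by
    intro i
    have := hm (vc i) i
    rw [SimpleGraph.dist_self, ← hheight] at this
    omega
  have height_iter : ∀ n x, height x = n → height (parent^[n] x) = 0 := by
    intro n
    induction n with
    | zero => intro x hx; simpa using hx
    | succ n ih =>
      intro x hx
      rw [Function.iterate_succ_apply]
      have := (hparent x (by omega)).2
      exact ih _ (by omega)
  have hfoot : ∀ x, ∃ i, vc i = parent^[height x] x := by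
    intro x
    have h := height_iter _ x rfl
    rw [hheight] at h
    exact ⟨_, (hG.1.dist_eq_zero_iff.1 h).symm⟩
  choose foot hfoot using hfoot
  have vc_foot : ∀ x, height x = 0 → vc (foot x) = x := by
    intro x hx
    rw [hfoot, hx]
    rfl
  have foot_parent : ∀ x, 0 < height x → foot (parent x) = foot x := by
    intro x hx
    apply hvc.1
    rw [hfoot, hfoot, ← (hparent x hx).2, Function.iterate_succ_apply]
  have foot_vc : ∀ i, foot (vc i) = i := fun i => hvc.1 (vc_foot _ (height_vc i))
  refine ⟨⟨height, foot, parent, height_vc, foot_vc, vc_foot, fun x hx => (hparent x hx).1,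
    fun x hx => (hparent x hx).2, foot_parent, hvc.2, ?_⟩⟩
  intro x y hxy
  by_contra hcon
  push Not at hcon
  obtain ⟨h1, h2, h3⟩ := hcon
  have hcyc : ∀ i, s(vc i, vc (i + 1)) ≠ s(x, y) := by
    intro i hi
    rw [Sym2.eq_iff] at hi
    rcases hi with ⟨rfl, rfl⟩ | ⟨rfl, rfl⟩
    · exact (h3 (height_vc _) (height_vc _)).1 (by rw [foot_vc, foot_vc])
    · exact (h3 (height_vc _) (height_vc _)).2 (by rw [foot_vc, foot_vc])
  have hreach : ∀ n z, height z = n →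
      (G.deleteEdges ({s(vc 0, vc 1)} ∪ {s(x, y)})).Reachable (vc 1) z := by
    intro n
    induction n with
    | zero =>
      intro z hz
      rw [← vc_foot z hz]
      refine reachable_along_cycle hg hvc _ (fun i hi => ?_) _
      exact hi.resolve_right (hcyc i)
    | succ n ih =>
      intro z hz
      have hz0 : 0 < height z := by omega
      obtain ⟨ha, hh⟩ := hparent z hz0
      refine (ih (parent z) (by omega)).trans (Adj.reachable ?_)
      rw [deleteEdges_adj]
      refine ⟨ha, ?_⟩
      rintro (h | h)
      · rw [Set.mem_singleton_iff, Sym2.eq_iff] at h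
        rcases h with ⟨-, h⟩ | ⟨-, h⟩ <;> · rw [h, height_vc] at hz0; omega
      · rw [Set.mem_singleton_iff, Sym2.eq_iff] at h
        rcases h with ⟨h, rfl⟩ | ⟨h, rfl⟩
        · exact h2 hz0 h
        · exact h1 hz0 h
  have hbr := isAcyclic_iff_forall_isBridge.1 (isAcyclic_deleteEdges_first hG hg hvc)
    (e := s(x, y)) (by
      rw [mem_edgeSet, deleteEdges_adj]
      refine ⟨hxy, fun h => hcyc 0 ?_⟩
      rw [zero_add]
      exact h.symm)
  rw [isBridge_iff, deleteEdges_deleteEdges] at hbr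
  exact hbr ((hreach _ x rfl).symm.trans (hreach _ y rfl))

end Rooting

/-- Distance from `0` to `z` in the cycle of length `g`. -/
def cycDist {g : ℕ} (z : ZMod g) : ℕ := min z.val (g - z.val)

section CycDist

variable {g : ℕ}

lemma cycDist_zero : cycDist (0 : ZMod g) = 0 := by simp [cycDist]

lemma cycDist_neg [NeZero g] (z : ZMod g) : cycDist (-z) = cycDist z := by
  unfold cycDist
  rw [ZMod.neg_val]
  have := ZMod.val_lt z
  split_ifs with h
  · subst h; simp
  · omega

lemma cycDist_sub_comm [NeZero g] (a b : ZMod g) : cycDist (a - b) = cycDist (b - a) := by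
  rw [← cycDist_neg, neg_sub]

lemma val_add_one_cases [NeZero g] (z : ZMod g) (hg : 1 < g) :
    (z.val + 1 < g ∧ (z + 1).val = z.val + 1) ∨ (z.val + 1 = g ∧ (z + 1).val = 0) := by
  have h := ZMod.val_lt z
  have := ZMod.val_add z 1
  rw [show (1 : ZMod g).val = 1 by rw [← Nat.cast_one, ZMod.val_natCast_of_lt hg]] at this
  rcases Nat.lt_or_ge (z.val + 1) g with h1 | h1
  · exact Or.inl ⟨h1, by rw [this, Nat.mod_eq_of_lt h1]⟩
  · have h2 : z.val + 1 = g := by omega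
    exact Or.inr ⟨h2, by rw [this, h2, Nat.mod_self]⟩

lemma cycDist_add_one_le [NeZero g] (hg : 1 < g) (z : ZMod g) :
    cycDist (z + 1) ≤ cycDist z + 1 ∧ cycDist z ≤ cycDist (z + 1) + 1 := by
  unfold cycDist
  have := val_add_one_cases z hg
  omega

end CycDist

section Dist

variable {V : Type*} {G : SimpleGraph V}

lemma dist_of_cut (hG : G.Connected) (X : Set V) {a w : V} (haw : G.Adj w a)
    (hcut : ∀ x y, G.Adj x y → x ∈ X → y ∉ X → x = a ∧ y = w) {x y : V} (hx : x ∈ X)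
    (hy : y ∉ X) : G.dist x y = G.dist x a + 1 + G.dist w y := by
  apply le_antisymm
  · have h1 := hG.dist_triangle (u := x) (v := a) (w := y)
    have h2 := hG.dist_triangle (u := a) (v := w) (w := y)
    rw [dist_eq_one_iff_adj.2 haw.symm] at h2
    omega
  · obtain ⟨p, hp⟩ := hG.exists_walk_length_eq_dist x y
    rw [← hp]
    clear hp
    induction p with
    | nil => exact absurd hx hy
    | @cons x z y hxz q ih =>
      rw [Walk.length_cons]
      by_cases hz : z ∈ X
      · have h1 := ih hz hy
        have h2 := hG.dist_triangle (u := x) (v := z) (w := a)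
        rw [dist_eq_one_iff_adj.2 hxz] at h2
        omega
      · obtain ⟨rfl, rfl⟩ := hcut x z hxz hx hz
        have := dist_le q
        rw [SimpleGraph.dist_self]
        omega

lemma le_dist_of_lipschitz (hG : G.Connected) (f : V → ℕ)
    (hf : ∀ x y, G.Adj x y → f y ≤ f x + 1) (x y : V) : f y ≤ f x + G.dist x y := by
  obtain ⟨p, hp⟩ := hG.exists_walk_length_eq_dist x y
  rw [← hp]
  clear hp
  induction p with
  | nil => simp
  | cons h q ih =>
    have := hf _ _ h
    rw [Walk.length_cons]
    omega

@[simp] lemma edgeDist_mk (s u w : V) :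
    edgeDist G s s(u, w) = min (G.dist s u) (G.dist s w) := rfl

end Dist

namespace CycleRooting

variable {V : Type*} {G : SimpleGraph V} {g : ℕ} {vc : ZMod g → V} (R : CycleRooting G g vc)

/-- `R.Below a x`: the vertex `x` lies in the subtree rooted at `a`. -/
inductive Below (a : V) : V → Prop
  | refl : Below a a
  | step (x : V) : 0 < R.height x → Below a (R.parent x) → Below a x

variable {R} {a b c x y s : V}

lemma Below.height_le (h : R.Below a x) : R.height a ≤ R.height x := by
  induction h with
  | refl => rfl
  | step x hx _ ih => have := R.height_parent x hx; omega

lemma Below.foot_eq (h : R.Below a x) : R.foot x = R.foot a := by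
  induction h with
  | refl => rfl
  | step x hx _ ih => rw [← R.foot_parent x hx, ih]

lemma Below.trans (h : R.Below a b) (h' : R.Below b x) : R.Below a x := by
  induction h' with
  | refl => exact h
  | step x hx _ ih => exact .step x hx ih

lemma Below.parent_of_ne (h : R.Below a x) (hne : x ≠ a) :
    0 < R.height x ∧ R.Below a (R.parent x) := by
  cases h with
  | refl => exact absurd rfl hne
  | step _ hx h => exact ⟨hx, h⟩

lemma Below.eq_of_height_le (h : R.Below a x) (hh : R.height x ≤ R.height a) : x = a := by
  by_contra hne
  obtain ⟨h0, h1⟩ := h.parent_of_ne hne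
  have := h1.height_le
  have := R.height_parent x h0
  omega

lemma Below.comparable (h : R.Below a x) (h' : R.Below b x) : R.Below a b ∨ R.Below b a := by
  induction h with
  | refl => exact Or.inr h'
  | step x hx h ih =>
    by_cases hxb : x = b
    · subst hxb; exact Or.inl (.step x hx h)
    · exact ih (h'.parent_of_ne hxb).2

lemma below_parent (hx : 0 < R.height x) : R.Below (R.parent x) x := .step x hx .refl

lemma not_below_parent (hx : 0 < R.height x) : ¬ R.Below x (R.parent x) := by
  intro h
  have := h.height_le
  have := R.height_parent x hx
  omega

lemma below_vc_foot (x : V) : R.Below (vc (R.foot x)) x := by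
  induction hn : R.height x generalizing x with
  | zero => rw [R.vc_foot x hn]; exact .refl
  | succ n ih =>
    have h0 : 0 < R.height x := by omega
    have := R.height_parent x h0
    rw [← R.foot_parent x h0]
    exact .step x h0 (ih _ (by omega))

lemma exists_below_height_one (hx : 0 < R.height x) :
    ∃ a, R.height a = 1 ∧ R.parent a = vc (R.foot x) ∧ R.Below a x := by
  induction hn : R.height x generalizing x with
  | zero => omega
  | succ n ih =>
    have h1 := R.height_parent x hx
    rcases Nat.eq_zero_or_pos n with rfl | hpos
    · refine ⟨x, hn, ?_, .refl⟩
      rw [← R.foot_parent x hx, R.vc_foot]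
      omega
    · obtain ⟨a, ha, hp, hb⟩ := ih (x := R.parent x) (by omega) (by omega)
      exact ⟨a, ha, by rw [hp, R.foot_parent x hx], .step x hx hb⟩

lemma Below.dist_add_height_le (hG : G.Connected) (h : R.Below a x) :
    G.dist x a + R.height a ≤ R.height x := by
  induction h with
  | refl => simp
  | step x hx _ ih =>
    have h1 := R.height_parent x hx
    have h2 := hG.dist_triangle (u := x) (v := R.parent x) (w := a)
    rw [dist_eq_one_iff_adj.2 (R.adj_parent x hx).symm] at h2
    omega

lemma below_cut (ha : 0 < R.height a) (hxy : G.Adj x y) (hx : R.Below a x) (hy : ¬ R.Below a y) :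
    x = a ∧ y = R.parent a := by
  rcases R.adj_cases x y hxy with ⟨h0, rfl⟩ | ⟨h0, rfl⟩ | ⟨h0, -⟩
  · by_cases h : x = a
    · subst h; exact ⟨rfl, rfl⟩
    · exact absurd (hx.parent_of_ne h).2 hy
  · exact absurd (.step y h0 hx) hy
  · have := hx.height_le; omega

lemma dist_below (hG : G.Connected) (ha : 0 < R.height a) (hx : R.Below a x)
    (hy : ¬ R.Below a y) : G.dist x y = G.dist x a + 1 + G.dist (R.parent a) y :=
  dist_of_cut hG {z | R.Below a z} (R.adj_parent a ha)
    (fun _ _ h h1 h2 => below_cut ha h h1 h2) hx hy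

lemma dist_eq_height_add (hG : G.Connected)
    (h : ∀ a, 0 < R.height a → R.Below a x → ¬ R.Below a y) :
    G.dist x y = R.height x + G.dist (vc (R.foot x)) y := by
  induction hn : R.height x generalizing x with
  | zero => rw [R.vc_foot x hn, zero_add]
  | succ n ih =>
    have h0 : 0 < R.height x := by omega
    have h1 := R.height_parent x h0
    rw [dist_below hG h0 .refl (h x h0 .refl), SimpleGraph.dist_self,
      ih (x := R.parent x) (fun a ha hb => h a ha (.step x h0 hb)) (by omega), R.foot_parent x h0]
    omega

lemma not_below_vc (ha : 0 < R.height a) (i : ZMod g) : ¬ R.Below a (vc i) := by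
  intro h
  have := h.height_le
  rw [R.height_vc] at this
  omega

lemma dist_vc (hG : G.Connected) (x : V) (i : ZMod g) :
    G.dist x (vc i) = R.height x + G.dist (vc (R.foot x)) (vc i) :=
  dist_eq_height_add hG fun _ ha _ => not_below_vc ha i

lemma dist_eq_of_not_common (hG : G.Connected)
    (h : ∀ a, 0 < R.height a → R.Below a x → ¬ R.Below a y) :
    G.dist x y = R.height x + G.dist (vc (R.foot x)) (vc (R.foot y)) + R.height y := by
  rw [dist_eq_height_add hG h, SimpleGraph.dist_comm, R.dist_vc hG y, SimpleGraph.dist_comm]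
  omega

lemma height_sub_le_dist (hG : G.Connected) (x y : V) :
    R.height y ≤ R.height x + G.dist x y := by
  refine le_dist_of_lipschitz hG R.height (fun u w huw => ?_) x y
  rcases R.adj_cases u w huw with ⟨h0, rfl⟩ | ⟨h0, rfl⟩ | ⟨h0, h1, -⟩
  · have := R.height_parent u h0; omega
  · have := R.height_parent w h0; omega
  · omega

lemma dist_vc_add_natCast_le (R : CycleRooting G g vc) (hG : G.Connected) (i : ZMod g) (n : ℕ) :
    G.dist (vc i) (vc (i + n)) ≤ n := by
  induction n with
  | zero => simp
  | succ n ih =>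
    have h := hG.dist_triangle (u := vc i) (v := vc (i + n)) (w := vc (i + (n + 1 : ℕ)))
    have h1 := R.adj_vc (i + n)
    rw [Nat.cast_succ, ← add_assoc] at *
    rw [dist_eq_one_iff_adj.2 h1] at h
    omega

lemma dist_vc_vc (R : CycleRooting G g vc) (hG : G.Connected) (hg : 1 < g) (i j : ZMod g) :
    G.dist (vc i) (vc j) = cycDist (j - i) := by
  have : NeZero g := ⟨by omega⟩
  have upper : ∀ i j : ZMod g, G.dist (vc i) (vc j) ≤ (j - i).val := by
    intro i j
    have h := R.dist_vc_add_natCast_le hG i (j - i).val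
    rwa [ZMod.natCast_zmod_val, add_sub_cancel] at h
  apply le_antisymm
  · have h1 := upper i j
    have h2 := upper j i
    rw [SimpleGraph.dist_comm, ← neg_sub j i, ZMod.neg_val] at h2
    unfold cycDist
    split_ifs at h2 <;> omega
  · have h := le_dist_of_lipschitz hG (fun x => cycDist (R.foot x - i)) (fun u w huw => ?_)
      (vc i) (vc j)
    · simpa [R.foot_vc, cycDist_zero] using h
    · rcases R.adj_cases u w huw with ⟨h0, rfl⟩ | ⟨h0, rfl⟩ | ⟨-, -, h | h⟩
      · simp only [R.foot_parent u h0]; omega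
      · simp only [R.foot_parent w h0]; omega
      · have := (cycDist_add_one_le hg (R.foot u - i)).1
        simp only [h]
        rwa [sub_add_eq_add_sub] at this
      · have := (cycDist_add_one_le hg (R.foot w - i)).2
        simp only [h]
        rwa [sub_add_eq_add_sub] at this

lemma edge_cases (R : CycleRooting G g vc) {e : Sym2 V} (he : e ∈ G.edgeSet) :
    (∃ c, 0 < R.height c ∧ e = s(R.parent c, c)) ∨ ∃ i, e = s(vc i, vc (i + 1)) := by
  induction e using Sym2.ind with
  | _ x y =>
    rcases R.adj_cases x y he with ⟨h0, h⟩ | ⟨h0, h⟩ | ⟨h0, h1, h | h⟩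
    · exact Or.inl ⟨x, h0, by rw [h, Sym2.eq_swap]⟩
    · exact Or.inl ⟨y, h0, by rw [h]⟩
    · exact Or.inr ⟨R.foot x, by rw [← h, R.vc_foot x h0, R.vc_foot y h1]⟩
    · exact Or.inr ⟨R.foot y, by rw [← h, R.vc_foot x h0, R.vc_foot y h1, Sym2.eq_swap]⟩

/-- The edge distance to a cycle edge. -/
lemma edgeDist_cycle (hG : G.Connected) (hg : 1 < g) (s : V) (i : ZMod g) :
    edgeDist G s s(vc i, vc (i + 1)) =
      R.height s + min (cycDist (i - R.foot s)) (cycDist (i + 1 - R.foot s)) := by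
  rw [edgeDist_mk, R.dist_vc hG s, R.dist_vc hG s, R.dist_vc_vc hG hg, R.dist_vc_vc hG hg,
    Nat.add_min_add_left]

lemma edgeDist_tree_of_not_common (hG : G.Connected) (hg : 1 < g) (hc : 0 < R.height c)
    (h : ∀ a, 0 < R.height a → R.Below a s → ¬ R.Below a c) :
    edgeDist G s s(R.parent c, c) =
      R.height s + cycDist (R.foot c - R.foot s) + (R.height c - 1) := by
  have h1 := R.height_parent c hc
  rw [edgeDist_mk, dist_eq_of_not_common hG h,
    dist_eq_of_not_common (R := R) hG (fun a ha hs hp => h a ha hs (.step c hc hp)),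
    R.foot_parent c hc, R.dist_vc_vc hG hg]
  omega

lemma edgeDist_tree_of_foot_ne (hG : G.Connected) (hg : 1 < g) (hc : 0 < R.height c)
    (h : R.foot s ≠ R.foot c) :
    edgeDist G s s(R.parent c, c) =
      R.height s + cycDist (R.foot c - R.foot s) + (R.height c - 1) :=
  edgeDist_tree_of_not_common hG hg hc
    fun _ _ h1 h2 => h (h1.foot_eq.trans h2.foot_eq.symm)

lemma edgeDist_tree_le (hG : G.Connected) (hc : 0 < R.height c)
    (h : R.foot s = R.foot c) :
    edgeDist G s s(R.parent c, c) ≤ R.height s + (R.height c - 1) := by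
  have h1 := R.height_parent c hc
  have h2 := hG.dist_triangle (u := s) (v := vc (R.foot s)) (w := R.parent c)
  rw [R.dist_vc hG s, SimpleGraph.dist_self, SimpleGraph.dist_comm (u := vc (R.foot s)),
    R.dist_vc hG, R.foot_parent c hc, h, SimpleGraph.dist_self] at h2
  rw [edgeDist_mk]
  omega

lemma edgeDist_tree_lt (hG : G.Connected) (ha : 0 < R.height a) (hs : R.Below a s)
    (hc : R.Below a c) :
    edgeDist G s s(R.parent c, c) < R.height s + (R.height c - 1) := by
  have h1 := hs.dist_add_height_le hG
  have h2 := hc.dist_add_height_le hG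
  have h3 := hG.dist_triangle (u := s) (v := a) (w := c)
  rw [SimpleGraph.dist_comm (u := a)] at h3
  rw [edgeDist_mk]
  omega

end CycleRooting

namespace CycleRooting

variable {V : Type*} {G : SimpleGraph V} {g : ℕ} {vc : ZMod g → V} {R : CycleRooting G g vc}
  {a b c v x y z s : V}

variable (R) in
/-- `R.LegList a t`: the list `t` enumerates the subtree rooted at `a` by increasing height,
without gaps. -/
def LegList (a : V) (t : List V) : Prop :=
  (∃ r, t = a :: r) ∧ t.Pairwise (fun x y => R.height x < R.height y) ∧
    (∀ y, y ∈ t ↔ R.Below a y) ∧ ∀ n, (∃ c ∈ t, R.height c = R.height a + n) ↔ n < t.length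

lemma vc_sub_one_ne (R : CycleRooting G g vc) (hg : 3 ≤ g) (i : ZMod g) :
    vc (i + 1) ≠ vc (i - 1) := by
  intro h
  have h1 := congrArg R.foot h
  rw [R.foot_vc, R.foot_vc] at h1
  have h2 : ((2 : ℕ) : ZMod g) = (0 : ℕ) := by
    push_cast
    linear_combination h1
  have := natCast_zmod_inj (by omega) (by omega) h2
  omega

lemma adj_cycle (R : CycleRooting G g vc) (hx : R.height x = 0) :
    G.Adj x (vc (R.foot x + 1)) ∧ G.Adj x (vc (R.foot x - 1)) := by
  have h1 := R.adj_vc (R.foot x)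
  have h2 := R.adj_vc (R.foot x - 1)
  rw [sub_add_cancel] at h2
  rw [R.vc_foot x hx] at h1 h2
  exact ⟨h1, h2.symm⟩

lemma below_iff_of_no_child (h : ∀ y, 0 < R.height y → R.parent y ≠ a) :
    R.Below a x ↔ x = a := by
  refine ⟨fun hx => ?_, fun hx => hx ▸ .refl⟩
  induction hx with
  | refl => rfl
  | step x h0 _ ih => exact absurd ih (h x h0)

lemma below_iff_of_unique_child (hb : 0 < R.height b) (hba : R.parent b = a)
    (h : ∀ y, 0 < R.height y → R.parent y = a → y = b) :
    R.Below a x ↔ x = a ∨ R.Below b x := by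
  constructor
  · intro hx
    induction hx with
    | refl => exact Or.inl rfl
    | step x h0 _ ih =>
      rcases ih with ih | ih
      · rw [h x h0 ih]; exact Or.inr .refl
      · exact Or.inr (.step x h0 ih)
  · rintro (rfl | hx)
    · exact .refl
    · exact (hba ▸ below_parent hb : R.Below a b).trans hx

lemma legList_singleton (h : ∀ y, 0 < R.height y → R.parent y ≠ a) : R.LegList a [a] := by
  refine ⟨⟨[], rfl⟩, by simp, fun y => by rw [below_iff_of_no_child h]; simp, fun n => ?_⟩
  simp only [List.mem_singleton, exists_eq_left, List.length_singleton]
  omega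

lemma LegList.cons {t : List V} (ht : R.LegList b t) (hb : 0 < R.height b)
    (hba : R.parent b = a) (h : ∀ y, 0 < R.height y → R.parent y = a → y = b) :
    R.LegList a (a :: t) := by
  obtain ⟨-, h2, h3, h4⟩ := ht
  have hh := R.height_parent b hb
  rw [hba] at hh
  refine ⟨⟨t, rfl⟩, ?_, fun y => ?_, fun n => ?_⟩
  · rw [List.pairwise_cons]
    refine ⟨fun y hy => ?_, h2⟩
    have := ((h3 y).1 hy).height_le
    omega
  · rw [List.mem_cons, h3, below_iff_of_unique_child hb hba h]
  · rw [List.length_cons]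
    constructor
    · rintro ⟨c, hc, hcn⟩
      rcases List.mem_cons.1 hc with rfl | hc
      · omega
      · have := ((h3 c).1 hc).height_le
        have := (h4 (n - 1)).1 ⟨c, hc, by omega⟩
        omega
    · intro hn
      rcases Nat.eq_zero_or_pos n with rfl | hpos
      · exact ⟨a, by simp, rfl⟩
      · obtain ⟨c, hc, hcn⟩ := (h4 (n - 1)).2 (by omega)
        exact ⟨c, List.mem_cons_of_mem _ hc, by omega⟩

lemma LegList.unique {t t' : List V} (ht : R.LegList a t) (ht' : R.LegList a t') : t = t' := by
  have nodup : ∀ {t}, R.LegList a t → t.Nodup := fun h =>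
    h.2.1.imp fun h e => by rw [e] at h; exact lt_irrefl _ h
  refine List.Perm.eq_of_pairwise (le := fun x y => R.height x < R.height y)
    (fun x y _ _ h1 h2 => absurd (h1.trans h2) (lt_irrefl _)) ht.2.1 ht'.2.1 ?_
  rw [List.perm_ext_iff_of_nodup (nodup ht) (nodup ht')]
  intro y
  rw [ht.2.2.1, ht'.2.2.1]

variable [Fintype V] [DecidableRel G.Adj]

variable (R) in
/-- `R.Leg a`: the subtree rooted at the off-cycle vertex `a` is a path starting at `a`. -/
def Leg (a : V) : Prop := 0 < R.height a ∧ ∀ x, R.Below a x → G.degree x ≤ 2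

lemma three_le_degree (h1 : G.Adj v x) (h2 : G.Adj v y) (h3 : G.Adj v z) (hxy : x ≠ y)
    (hxz : x ≠ z) (hyz : y ≠ z) : 3 ≤ G.degree v := by
  classical
  have hs : ({x, y, z} : Finset V) ⊆ G.neighborFinset v := by
    intro u hu
    simp only [Finset.mem_insert, Finset.mem_singleton] at hu
    rcases hu with rfl | rfl | rfl <;> simpa
  have := Finset.card_le_card hs
  rwa [Finset.card_eq_three.2 ⟨x, y, z, hxy, hxz, hyz, rfl⟩] at this

lemma three_le_degree_of_child (hg : 3 ≤ g) (hx : R.height x = 0) (hy : 0 < R.height y)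
    (hp : R.parent y = x) : 3 ≤ G.degree x := by
  obtain ⟨h1, h2⟩ := R.adj_cycle hx
  have h3 := R.adj_parent y hy
  rw [hp] at h3
  refine three_le_degree h3 h1 h2 ?_ ?_ (R.vc_sub_one_ne hg _)
  · rintro rfl; rw [R.height_vc] at hy; omega
  · rintro rfl; rw [R.height_vc] at hy; omega

lemma three_le_degree_of_children (hg : 3 ≤ g) (hy : 0 < R.height y) (hz : 0 < R.height z)
    (hyz : y ≠ z) (hp : R.parent y = R.parent z) : 3 ≤ G.degree (R.parent y) := by
  rcases Nat.eq_zero_or_pos (R.height (R.parent y)) with h | h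
  · exact three_le_degree_of_child hg h hy rfl
  · have h1 := R.height_parent _ h
    have h2 := R.height_parent y hy
    have h3 := R.height_parent z hz
    have h4 := R.adj_parent z hz
    rw [← hp] at h3 h4
    refine three_le_degree (R.adj_parent y hy) h4 (R.adj_parent _ h).symm hyz ?_ ?_
    · intro h; rw [← h] at h1; omega
    · intro h; rw [← h] at h1; omega

/-- Every branching vertex has two children. -/
lemma exists_children_of_branching (hx : Branching G g vc x) :
    ∃ y z, y ≠ z ∧ 0 < R.height y ∧ 0 < R.height z ∧ R.parent y = x ∧ R.parent z = x := by
  classical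
  have key : ∀ F : Finset V, F.card + 2 ≤ G.degree x →
      (∀ y, G.Adj x y → y ∈ F ∨ 0 < R.height y ∧ R.parent y = x) →
      ∃ y z, y ≠ z ∧ 0 < R.height y ∧ 0 < R.height z ∧ R.parent y = x ∧ R.parent z = x := by
    intro F hF hadj
    have h1 := Finset.le_card_sdiff F (G.neighborFinset x)
    rw [card_neighborFinset_eq_degree] at h1
    obtain ⟨y, hy, z, hz, hyz⟩ := Finset.one_lt_card.1 (show 1 < (G.neighborFinset x \ F).card by
      omega)
    rw [Finset.mem_sdiff, mem_neighborFinset] at hy hz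
    have hy' := (hadj y hy.1).resolve_left hy.2
    have hz' := (hadj z hz.1).resolve_left hz.2
    exact ⟨y, z, hyz, hy'.1, hz'.1, hy'.2, hz'.2⟩
  rcases hx with ⟨hr, hd⟩ | ⟨⟨i, rfl⟩, hd⟩
  · refine key {R.parent x} (by simpa using hd) fun y hxy => ?_
    rcases R.adj_cases x y hxy with ⟨-, h⟩ | h | ⟨h, -⟩
    · exact Or.inl (by simp [h])
    · exact Or.inr h
    · exact absurd ⟨_, R.vc_foot x h⟩ hr
  · refine key {vc (i + 1), vc (i - 1)} ?_ fun y hxy => ?_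
    · have := Finset.card_le_two (a := vc (i + 1)) (b := vc (i - 1))
      omega
    · rcases R.adj_cases _ y hxy with ⟨h, -⟩ | h | ⟨-, h0, h | h⟩
      · rw [R.height_vc] at h; omega
      · exact Or.inr h
      · rw [R.foot_vc] at h
        exact Or.inl (by rw [← R.vc_foot y h0, h]; simp)
      · rw [R.foot_vc] at h
        refine Or.inl ?_
        rw [← R.vc_foot y h0, h, add_sub_cancel_right]
        simp

lemma eq_or_eq_of_degree_eq_two (hd : G.degree v = 2) (hx : G.Adj v x) (hy : G.Adj v y)
    (hxy : x ≠ y) (hz : G.Adj v z) : z = x ∨ z = y := by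
  by_contra! h
  have := three_le_degree hx hy hz hxy (Ne.symm h.1) (Ne.symm h.2)
  omega

lemma eq_of_degree_eq_one (hd : G.degree v = 1) (hx : G.Adj v x) (hz : G.Adj v z) : z = x := by
  rw [← card_neighborFinset_eq_degree, Finset.card_eq_one] at hd
  obtain ⟨w, hw⟩ := hd
  have h1 : x ∈ G.neighborFinset v := by simpa
  have h2 : z ∈ G.neighborFinset v := by simpa
  rw [hw, Finset.mem_singleton] at h1 h2
  rw [h1, h2]

/-- A list shaped like a thread below `v` is the list of a subtree rooted at a child of `v`. -/
lemma exists_legList_of_chain (hg : 3 ≤ g) (t : List V) (v : V) (hne : t ≠ [])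
    (hnd : (v :: t).Nodup) (hch : List.IsChain G.Adj (v :: t))
    (hlast : ∀ u ∈ t.getLast?, G.degree u = 1) (hdrop : ∀ u ∈ t.dropLast, G.degree u = 2) :
    ∃ a, 0 < R.height a ∧ R.parent a = v ∧ R.LegList a t := by
  induction t generalizing v with
  | nil => exact absurd rfl hne
  | cons a r ih =>
    rw [List.isChain_cons_cons] at hch
    obtain ⟨hva, hch⟩ := hch
    have hnd' := (List.nodup_cons.1 hnd)
    rcases r with _ | ⟨b, r⟩
    · have hd : G.degree a = 1 := hlast a (by simp)
      have h0 : 0 < R.height a := by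
        by_contra h
        obtain ⟨h1, h2⟩ := R.adj_cycle (x := a) (by omega)
        exact R.vc_sub_one_ne hg _ (eq_of_degree_eq_one hd h2 h1)
      have hp : R.parent a = v := eq_of_degree_eq_one hd hva.symm (R.adj_parent a h0).symm
      refine ⟨a, h0, hp, legList_singleton fun y hy hya => ?_⟩
      have h1 := R.adj_parent y hy
      rw [hya] at h1
      have h2 := eq_of_degree_eq_one hd hva.symm h1
      have h3 := R.height_parent a h0
      have h4 := R.height_parent y hy
      rw [hp, ← h2] at h3
      rw [hya] at h4
      omega
    · obtain ⟨b', hb0, hba, hl⟩ := ih a (by simp) hnd'.2 hch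
        (fun u hu => hlast u (by simpa [List.getLast?_cons_cons] using hu))
        (fun u hu => hdrop u (by rw [List.dropLast_cons_cons]; exact List.mem_cons_of_mem _ hu))
      obtain rfl : b = b' := by obtain ⟨r', hr'⟩ := hl.1; exact (List.cons.inj hr').1
      have hd : G.degree a = 2 := hdrop a (by simp)
      have hvb : v ≠ b := by rintro rfl; exact hnd'.1 (by simp)
      have hab : G.Adj a b := hba ▸ R.adj_parent b hb0
      have h0 : 0 < R.height a := by
        by_contra h
        have := three_le_degree_of_child hg (x := a) (by omega) hb0 hba
        omega
      have hh1 := R.height_parent a h0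
      have hh2 := R.height_parent b hb0
      rw [hba] at hh2
      have hp : R.parent a = v := by
        refine (eq_or_eq_of_degree_eq_two hd hva.symm hab hvb
          (R.adj_parent a h0).symm).resolve_right fun h => ?_
        rw [h] at hh1
        omega
      refine ⟨a, h0, hp, hl.cons hb0 hba fun y hy hya => ?_⟩
      refine (eq_or_eq_of_degree_eq_two hd hva.symm hab hvb
        (hya ▸ R.adj_parent y hy)).resolve_left fun h => ?_
      have h4 := R.height_parent y hy
      rw [hya, h, ← hp] at h4
      omega

lemma exists_leg_of_isThreadAt (R : CycleRooting G g vc) (hg : 3 ≤ g) {t : List V}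
    (ht : IsThreadAt G v t) : ∃ a, R.Leg a ∧ R.parent a = v ∧ R.LegList a t := by
  obtain ⟨hne, hnd, hv, -, hch, hhead, hlast, hdrop⟩ := ht
  have hch' : List.IsChain G.Adj (v :: t) := by
    rw [List.isChain_cons]
    exact ⟨hhead, hch⟩
  obtain ⟨a, h0, hp, hl⟩ := exists_legList_of_chain (R := R) hg t v hne
    (List.nodup_cons.2 ⟨hv, hnd⟩) hch' hlast hdrop
  refine ⟨a, ⟨h0, fun x hx => ?_⟩, hp, hl⟩
  rw [← hl.2.2.1, ← List.dropLast_append_getLast hne, List.mem_append, List.mem_singleton] at hx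
  rcases hx with hx | rfl
  · exact (hdrop x hx).le
  · rw [hlast _ (List.getLast?_eq_getLast_of_ne_nil hne)]
    omega

lemma branching_of_height_pos (hx : 0 < R.height x) (hd : 3 ≤ G.degree x) : Branching G g vc x :=
  Or.inl ⟨by rintro ⟨i, rfl⟩; rw [R.height_vc] at hx; omega, hd⟩

lemma Leg.exists_chain (ha : R.Leg a) :
    ∃ t, R.LegList a t ∧ List.IsChain G.Adj t ∧ (∀ u ∈ t.getLast?, G.degree u = 1) ∧
      ∀ u ∈ t.dropLast, G.degree u = 2 := by
  obtain ⟨N, hN⟩ : ∃ N, ∀ x, R.height x ≤ N := by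
    obtain ⟨N, hN⟩ := (Set.finite_range R.height).bddAbove
    exact ⟨N, fun x => hN ⟨x, rfl⟩⟩
  induction hn : N - R.height a using Nat.strong_induction_on generalizing a with
  | _ n ih =>
  have hpa := (R.adj_parent a ha.1).symm
  have hd2 := ha.2 a .refl
  by_cases hch : ∃ b, 0 < R.height b ∧ R.parent b = a
  · obtain ⟨b, hb, hba⟩ := hch
    have hh := R.height_parent b hb
    rw [hba] at hh
    have hab : R.Below a b := hba ▸ below_parent hb
    obtain ⟨t, h1, h2, h3, h4⟩ := ih (N - R.height b) (by have := hN b; omega)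
      (a := b) ⟨hb, fun x hx => ha.2 x (hab.trans hx)⟩ rfl
    have hadj : G.Adj a b := hba ▸ R.adj_parent b hb
    have hne : R.parent a ≠ b := by
      intro h
      have := R.height_parent a ha.1
      rw [h] at this
      omega
    have hl := h1.cons hb hba fun y hy hya => by
      by_contra hyb
      have hy' : G.Adj a y := hya ▸ R.adj_parent y hy
      have hney : R.parent a ≠ y := by
        intro h
        have h5 := R.height_parent a ha.1
        have h6 := R.height_parent y hy
        rw [h] at h5
        rw [hya] at h6
        omega
      have := three_le_degree hpa hadj hy' hne hney (Ne.symm hyb)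
      omega
    obtain ⟨⟨r, rfl⟩, -⟩ := h1
    refine ⟨_, hl, List.isChain_cons_cons.2 ⟨hadj, h2⟩, ?_, ?_⟩
    · rwa [List.getLast?_cons_cons]
    · rw [List.dropLast_cons_cons]
      intro u hu
      rcases List.mem_cons.1 hu with rfl | hu
      · have : 1 < G.degree u := by
          rw [← card_neighborFinset_eq_degree, Finset.one_lt_card]
          exact ⟨_, by simpa using hpa, b, by simpa using hadj, hne⟩
        omega
      · exact h4 u hu
  · push Not at hch
    refine ⟨[a], legList_singleton hch, by simp, ?_, by simp⟩
    intro u hu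
    obtain rfl : a = u := by simpa using hu
    rw [← card_neighborFinset_eq_degree, Finset.card_eq_one]
    refine ⟨R.parent a, ?_⟩
    ext y
    rw [mem_neighborFinset, Finset.mem_singleton]
    refine ⟨fun hy => ?_, fun h => h ▸ hpa⟩
    rcases R.adj_cases a y hy with ⟨-, h⟩ | ⟨h0, h⟩ | ⟨h0, -⟩
    · exact h.symm
    · exact absurd h (hch y h0)
    · exact absurd ha.1 (by omega)

lemma Leg.exists_thread (ha : R.Leg a) (hd : 3 ≤ G.degree (R.parent a)) :
    ∃ t, IsThreadAt G (R.parent a) t ∧ R.LegList a t := by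
  obtain ⟨t, hl, h2, h3, h4⟩ := ha.exists_chain
  refine ⟨t, ⟨?_, ?_, ?_, hd, h2, ?_, h3, h4⟩, hl⟩
  · obtain ⟨⟨r, rfl⟩, -⟩ := hl
    simp
  · exact hl.2.1.imp fun h e => by rw [e] at h; exact lt_irrefl _ h
  · rw [hl.2.2.1]
    exact not_below_parent ha.1
  · obtain ⟨⟨r, rfl⟩, -⟩ := hl
    simpa using R.adj_parent a ha.1

lemma not_two_free_legs {S : Set V} (hg : 3 ≤ g) (hS : BranchResolving G S) (ha : R.Leg a)
    (hb : R.Leg b) (hab : a ≠ b) (hp : R.parent a = R.parent b) (hfa : ∀ s ∈ S, ¬ R.Below a s)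
    (hfb : ∀ s ∈ S, ¬ R.Below b s) : False := by
  have hd := three_le_degree_of_children hg ha.1 hb.1 hab hp
  obtain ⟨t, ht, hl⟩ := ha.exists_thread hd
  obtain ⟨t', ht', hl'⟩ := hb.exists_thread (hp ▸ hd)
  rw [← hp] at ht'
  have hne : t ≠ t' := by
    rintro rfl
    obtain ⟨r, hr⟩ := hl.1
    obtain ⟨r', hr'⟩ := hl'.1
    rw [hr] at hr'
    exact hab (List.cons.inj hr').1
  rcases hS _ t t' ht ht' hne with ⟨s, hs, h⟩ | ⟨s, hs, h⟩
  · exact hfa s hs ((hl.2.2.1 s).1 h)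
  · exact hfb s hs ((hl'.2.2.1 s).1 h)

/-- A subtree missed by a branch-resolving set is a leg. -/
lemma leg_of_free {S : Set V} (hg : 3 ≤ g) (hS : BranchResolving G S) (ha : 0 < R.height a)
    (hfa : ∀ s ∈ S, ¬ R.Below a s) : R.Leg a := by
  obtain ⟨N, hN⟩ : ∃ N, ∀ x, R.height x ≤ N := by
    obtain ⟨N, hN⟩ := (Set.finite_range R.height).bddAbove
    exact ⟨N, fun x => hN ⟨x, rfl⟩⟩
  induction hn : N - R.height a using Nat.strong_induction_on generalizing a with
  | _ n ih =>
  refine ⟨ha, fun x hx => ?_⟩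
  by_contra hd
  have hax := hx.height_le
  obtain ⟨y, z, hyz, hy, hz, hyx, hzx⟩ := exists_children_of_branching (R := R)
    (branching_of_height_pos (R := R) (x := x) (by omega) (by omega))
  have child : ∀ w, 0 < R.height w → R.parent w = x →
      (∀ s ∈ S, ¬ R.Below w s) ∧ R.Leg w := by
    intro w hw hwx
    have hf : ∀ s ∈ S, ¬ R.Below w s := fun s hs h =>
      hfa s hs ((hx.trans (hwx ▸ below_parent hw)).trans h)
    have h1 := R.height_parent w hw
    rw [hwx] at h1
    exact ⟨hf, ih (N - R.height w) (by have := hN w; omega) hw hf rfl⟩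
  exact not_two_free_legs hg hS (child y hy hyx).2 (child z hz hzx).2 hyz (hyx.trans hzx.symm)
    (child y hy hyx).1 (child z hz hzx).1

/-- A branch-active tree contains a vertex of every branch-resolving set. -/
lemma exists_foot_eq_of_branching {S : Set V} (hg : 3 ≤ g) (hS : BranchResolving G S)
    (hx : Branching G g vc x) : ∃ s ∈ S, R.foot s = R.foot x := by
  by_contra! hcon
  obtain ⟨y, z, hyz, hy, hz, hyx, hzx⟩ := exists_children_of_branching (R := R) hx
  have child : ∀ w, 0 < R.height w → R.parent w = x → ∀ s ∈ S, ¬ R.Below w s := by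
    intro w hw hwx s hs h
    refine hcon s hs ?_
    rw [h.foot_eq, ← R.foot_parent w hw, hwx]
  have h1 := child y hy hyx
  have h2 := child z hz hzx
  exact not_two_free_legs hg hS (leg_of_free hg hS hy h1) (leg_of_free hg hS hz h2) hyz
    (hyx.trans hzx.symm) h1 h2

end CycleRooting

namespace CycleRooting

variable {V : Type*} [Fintype V] {G : SimpleGraph V} [DecidableRel G.Adj] {g : ℕ}
  {vc : ZMod g → V} {R : CycleRooting G g vc} {a b c v w x y z s : V}

variable (R) in
open scoped Classical in
/-- The first vertices of the threads hanging at `v`. -/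
noncomputable def legsAt (v : V) : Finset V :=
  Finset.univ.filter fun a => R.Leg a ∧ R.parent a = v ∧ 3 ≤ G.degree v

variable (R) in
open scoped Classical in
/-- The first vertices of the threads hanging at `v` that meet `S`. -/
noncomputable def hitLegsAt (S : Finset V) (v : V) : Finset V :=
  (R.legsAt v).filter fun a => ∃ s ∈ S, R.Below a s

lemma mem_legsAt : a ∈ R.legsAt v ↔ R.Leg a ∧ R.parent a = v ∧ 3 ≤ G.degree v := by
  simp [legsAt]

lemma mem_hitLegsAt {S : Finset V} :
    a ∈ R.hitLegsAt S v ↔ a ∈ R.legsAt v ∧ ∃ s ∈ S, R.Below a s := by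
  simp [hitLegsAt]

lemma exists_mem_legsAt_of_isThreadAt (R : CycleRooting G g vc) (hg : 3 ≤ g) {t : List V}
    (ht : IsThreadAt G v t) : ∃ a ∈ R.legsAt v, R.LegList a t := by
  obtain ⟨a, ha, hp, hl⟩ := R.exists_leg_of_isThreadAt hg ht
  exact ⟨a, mem_legsAt.2 ⟨ha, hp, ht.2.2.2.1⟩, hl⟩

lemma exists_thread_of_mem_legsAt (ha : a ∈ R.legsAt v) :
    ∃ t, IsThreadAt G v t ∧ R.LegList a t := by
  obtain ⟨h1, rfl, h3⟩ := mem_legsAt.1 ha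
  exact h1.exists_thread h3

lemma numThreads_eq_card (R : CycleRooting G g vc) (hg : 3 ≤ g) (v : V) :
    numThreads G v = (R.legsAt v).card := by
  have heads : ∀ t (ht : IsThreadAt G v t),
      t.head ht.1 ∈ R.legsAt v ∧ R.LegList (t.head ht.1) t := by
    intro t ht
    obtain ⟨a, ha, hl⟩ := R.exists_mem_legsAt_of_isThreadAt hg ht
    obtain ⟨⟨r, rfl⟩, -⟩ := id hl
    exact ⟨ha, hl⟩
  rw [numThreads, ← Set.ncard_coe_finset]
  refine Set.ncard_congr (fun t ht => t.head ht.1) (fun t ht => (heads t ht).1) ?_ ?_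
  · intro t t' ht ht' h
    have h1 := (heads t ht).2
    rw [show t.head ht.1 = t'.head ht'.1 from h] at h1
    exact h1.unique (heads t' ht').2
  · intro a ha
    obtain ⟨t, ht, hl⟩ := exists_thread_of_mem_legsAt (Finset.mem_coe.1 ha)
    obtain ⟨⟨r, rfl⟩, -⟩ := hl
    exact ⟨_, ht, rfl⟩

lemma eq_of_mem_legsAt_of_below (ha : a ∈ R.legsAt v) (hb : b ∈ R.legsAt w)
    (has : R.Below a s) (hbs : R.Below b s) : a = b := by
  obtain ⟨hla, rfl, hda⟩ := mem_legsAt.1 ha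
  obtain ⟨hlb, rfl, hdb⟩ := mem_legsAt.1 hb
  by_contra hne
  rcases has.comparable hbs with h | h
  · have := hla.2 _ (h.parent_of_ne (Ne.symm hne)).2
    omega
  · have := hlb.2 _ (h.parent_of_ne hne).2
    omega

lemma BranchResolving.card_legsAt_le {S : Finset V} (R : CycleRooting G g vc) (hg : 3 ≤ g)
    (hS : BranchResolving G (S : Set V)) (v : V) :
    (R.legsAt v).card - 1 ≤ (R.hitLegsAt S v).card := by
  classical
  have h1 : (R.legsAt v \ R.hitLegsAt S v).card ≤ 1 := by
    rw [Finset.card_le_one]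
    intro a ha b hb
    by_contra hab
    rw [Finset.mem_sdiff, mem_hitLegsAt] at ha hb
    obtain ⟨h1, h2, -⟩ := mem_legsAt.1 ha.1
    obtain ⟨h3, h4, -⟩ := mem_legsAt.1 hb.1
    exact not_two_free_legs hg hS h1 h3 hab (h2.trans h4.symm)
      (fun s hs h => ha.2 ⟨ha.1, s, hs, h⟩) fun s hs h => hb.2 ⟨hb.1, s, hs, h⟩
  have h2 := Finset.le_card_sdiff (R.hitLegsAt S v) (R.legsAt v)
  omega

lemma sum_card_hitLegsAt_le (S : Finset V) (p : V → Prop) [DecidablePred p]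
    (hp : ∀ s ∈ S, ∀ v, ∀ a ∈ R.legsAt v, R.Below a s → p s) :
    ∑ v, (R.hitLegsAt S v).card ≤ (S.filter p).card := by
  classical
  rw [← Finset.card_biUnion]
  · have h : ∀ a ∈ Finset.univ.biUnion (R.hitLegsAt S), ∃ s ∈ S.filter p, R.Below a s := by
      intro a ha
      obtain ⟨v, -, ha⟩ := Finset.mem_biUnion.1 ha
      obtain ⟨ha, s, hs, has⟩ := mem_hitLegsAt.1 ha
      exact ⟨s, Finset.mem_filter.2 ⟨hs, hp s hs v a ha has⟩, has⟩
    choose! f hf hb using h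
    refine Finset.card_le_card_of_injOn f hf fun a ha b hb' hab => ?_
    have h1 := hb a ha
    have h2 := hb b hb'
    rw [← show f a = f b from hab] at h2
    obtain ⟨v, -, ha⟩ := Finset.mem_biUnion.1 ha
    obtain ⟨w, -, hb'⟩ := Finset.mem_biUnion.1 hb'
    exact eq_of_mem_legsAt_of_below (mem_hitLegsAt.1 ha).1 (mem_hitLegsAt.1 hb').1 h1 h2
  · intro v _ w _ hvw
    rw [Function.onFun, Finset.disjoint_left]
    intro a ha hb
    have h1 := (mem_legsAt.1 (mem_hitLegsAt.1 ha).1).2.1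
    have h2 := (mem_legsAt.1 (mem_hitLegsAt.1 hb).1).2.1
    exact hvw (h1.symm.trans h2)

lemma LG_eq_sum (R : CycleRooting G g vc) (hg : 3 ≤ g) :
    LG G = ∑ v, ((R.legsAt v).card - 1) := by
  simp only [LG, R.numThreads_eq_card hg]

lemma LG_le_card {S : Finset V} (R : CycleRooting G g vc) (hg : 3 ≤ g)
    (hS : BranchResolving G (S : Set V)) : LG G ≤ S.card := by
  classical
  rw [R.LG_eq_sum hg]
  refine (Finset.sum_le_sum fun v _ => BranchResolving.card_legsAt_le R hg hS v).trans
    ((sum_card_hitLegsAt_le S (fun _ => True) fun _ _ _ _ _ _ => trivial).trans ?_)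
  exact Finset.card_filter_le _ _

lemma exists_branchResolving_card (R : CycleRooting G g vc) (hg : 3 ≤ g) :
    ∃ S : Finset V, BranchResolving G (S : Set V) ∧ S.card ≤ LG G := by
  classical
  have hch : ∀ v, ∃ F : Finset V, F ⊆ R.legsAt v ∧ F.card ≤ (R.legsAt v).card - 1 ∧
      ∀ a ∈ R.legsAt v, ∀ b ∈ R.legsAt v, a ≠ b → a ∈ F ∨ b ∈ F := by
    intro v
    rcases (R.legsAt v).eq_empty_or_nonempty with h | ⟨c, hc⟩
    · exact ⟨∅, by simp, by simp, by simp [h]⟩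
    · refine ⟨(R.legsAt v).erase c, Finset.erase_subset _ _, (Finset.card_erase_of_mem hc).le, ?_⟩
      intro a ha b hb hab
      rw [Finset.mem_erase, Finset.mem_erase]
      by_cases hac : a = c
      · exact Or.inr ⟨fun h => hab (hac.trans h.symm), hb⟩
      · exact Or.inl ⟨hac, ha⟩
  choose F _ hF hF' using hch
  refine ⟨Finset.univ.biUnion F, ?_, ?_⟩
  · intro v t₁ t₂ h₁ h₂ hne
    obtain ⟨a, ha, hla⟩ := R.exists_mem_legsAt_of_isThreadAt hg h₁
    obtain ⟨b, hb, hlb⟩ := R.exists_mem_legsAt_of_isThreadAt hg h₂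
    have hab : a ≠ b := by
      rintro rfl
      exact hne (hla.unique hlb)
    refine (hF' v a ha b hb hab).imp (fun h => ⟨a, ?_, (hla.2.2.1 a).2 .refl⟩)
      fun h => ⟨b, ?_, (hlb.2.2.1 b).2 .refl⟩ <;> simpa using ⟨v, h⟩
  · rw [R.LG_eq_sum hg]
    exact Finset.card_biUnion_le.trans (Finset.sum_le_sum fun v _ => hF v)

lemma SmallestBR.card_eq {S : Finset V} (R : CycleRooting G g vc) (hg : 3 ≤ g)
    (hS : SmallestBR G S) : S.card = LG G := by
  obtain ⟨S', h1, h2⟩ := R.exists_branchResolving_card hg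
  exact le_antisymm ((hS.2 S' h1).trans h2) (R.LG_le_card hg hS.1)

section Minimal

variable {S : Finset V}

lemma card_hitLegsAt_of_card_eq (hg : 3 ≤ g) (hS : BranchResolving G (S : Set V))
    (hc : S.card = LG G) (v : V) :
    (R.hitLegsAt S v).card = (R.legsAt v).card - 1 := by
  classical
  have h1 := sum_card_hitLegsAt_le (R := R) S (fun _ => True) fun _ _ _ _ _ _ => trivial
  rw [Finset.filter_true_of_mem fun _ _ => trivial, hc, R.LG_eq_sum hg] at h1
  have h2 := fun v (_ : v ∈ Finset.univ) => BranchResolving.card_legsAt_le R hg hS v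
  exact ((Finset.sum_eq_sum_iff_of_le h2).1 (le_antisymm (Finset.sum_le_sum h2) h1) v
    (Finset.mem_univ v)).symm

lemma exists_mem_hitLegsAt_of_card_eq (hg : 3 ≤ g) (hS : BranchResolving G (S : Set V))
    (hc : S.card = LG G) (hs : s ∈ S) :
    ∃ v, ∃ a ∈ R.hitLegsAt S v, R.Below a s := by
  classical
  have h1 := sum_card_hitLegsAt_le (R := R) S (fun s => ∃ v, ∃ a ∈ R.legsAt v, R.Below a s)
    fun s _ v a ha h => ⟨v, a, ha, h⟩
  have h2 : LG G ≤ ∑ v, (R.hitLegsAt S v).card := by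
    rw [R.LG_eq_sum hg]
    exact Finset.sum_le_sum fun v _ => BranchResolving.card_legsAt_le R hg hS v
  have h3 := Finset.eq_of_subset_of_card_le (Finset.filter_subset _ S)
    (hc.le.trans (h2.trans h1))
  rw [← h3] at hs
  obtain ⟨hs, v, a, ha, has⟩ := Finset.mem_filter.1 hs
  exact ⟨v, a, mem_hitLegsAt.2 ⟨ha, s, hs, has⟩, has⟩

lemma exists_foot_iff_of_card_eq (hg : 3 ≤ g) (hS : BranchResolving G (S : Set V))
    (hc : S.card = LG G) (i : ZMod g) :
    (∃ s ∈ S, R.foot s = i) ↔ ∃ v, R.foot v = i ∧ 1 < (R.legsAt v).card := by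
  constructor
  · rintro ⟨s, hs, rfl⟩
    obtain ⟨v, a, ha, has⟩ := exists_mem_hitLegsAt_of_card_eq (R := R) hg hS hc hs
    have h1 := card_hitLegsAt_of_card_eq (R := R) hg hS hc v
    have h2 := Finset.card_pos.2 ⟨a, ha⟩
    obtain ⟨h3, h4, -⟩ := mem_legsAt.1 (mem_hitLegsAt.1 ha).1
    refine ⟨v, ?_, by omega⟩
    rw [has.foot_eq, ← h4, R.foot_parent a h3.1]
  · rintro ⟨v, rfl, hv⟩
    have h1 := card_hitLegsAt_of_card_eq (R := R) hg hS hc v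
    obtain ⟨a, ha⟩ := Finset.card_pos.1 (show 0 < (R.hitLegsAt S v).card by omega)
    obtain ⟨ha, s, hs, has⟩ := mem_hitLegsAt.1 ha
    obtain ⟨h3, h4, -⟩ := mem_legsAt.1 ha
    exact ⟨s, hs, by rw [has.foot_eq, ← h4, R.foot_parent a h3.1]⟩

lemma exists_free_leg_of_card_eq (hg : 3 ≤ g) (hS : BranchResolving G (S : Set V))
    (hc : S.card = LG G) (hv : (R.legsAt v).Nonempty) :
    ∃ a ∈ R.legsAt v, ∀ s ∈ S, ¬ R.Below a s := by
  have h1 := card_hitLegsAt_of_card_eq (R := R) hg hS hc v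
  have h2 := Finset.card_pos.2 hv
  obtain ⟨a, ha, hna⟩ := Finset.exists_mem_notMem_of_card_lt_card
    (show (R.hitLegsAt S v).card < (R.legsAt v).card by omega)
  exact ⟨a, ha, fun s hs h => hna (mem_hitLegsAt.2 ⟨ha, s, hs, h⟩)⟩

end Minimal

end CycleRooting

/-- Distance between the positions `a` and `b` on a cycle of length `g`. -/
def posDist (g a b : ℕ) : ℕ := min (a - b + (b - a)) (g - (a - b + (b - a)))

/-- Cyclic form of the configurations, for a set `A` of active positions and a predicate `F i n`
expressing that a free thread reaching height `n` hangs at position `i`. -/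
def CyclicConfig {g : ℕ} (A : Set (ZMod g)) (F : ZMod g → ℕ → Prop) : Prop :=
  (∃ i, F i 1 ∧ ((∀ x < g, i + (x : ℕ) ∈ A → x ≤ (g - 1) / 2) ∨
    ∀ x < g, i - (x : ℕ) ∈ A → x ≤ (g - 1) / 2)) ∨
  (Even g ∧ ∃ a, ∀ m ∈ A, m = a ∨ m = a + (g / 2 : ℕ)) ∨
  ∃ a, ∃ k i : ℕ, k ≤ g / 2 ∧ i ≤ k ∧ (∀ m ∈ A, m = a ∨ m = a + (k : ℕ)) ∧
    F (a + (i : ℕ)) (g / 2 - k + 1) ∧ (Even g → F (a + (g / 2 + k - i : ℕ)) 1)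

section Cyclic

variable {g : ℕ} {A : Set (ZMod g)} {F : ZMod g → ℕ → Prop}

lemma min_posDist_of_le {E x : ℕ} (hE : E < g) (hx : x ≤ E) :
    min (posDist g E x) (posDist g (E + 1) x) = min (E - x) (g - 1 - E + x) := by
  unfold posDist
  omega

lemma min_posDist_of_lt {E x : ℕ} (hxg : x < g) (hx : E < x) :
    min (posDist g E x) (posDist g (E + 1) x) = min (x - E - 1) (g + E - x) := by
  unfold posDist
  omega

lemma cycle_edge_solutions {E p x : ℕ} (hE : E < g) (hx : x < g) (hx0 : x ≠ 0)
    (h : min (posDist g E x) (posDist g (E + 1) x) = posDist g 0 x + p) :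
    p ≤ min E (g - 1 - E) ∧
      (p = min E (g - 1 - E) → (2 * E + 1 ≤ g → g < 2 * x) ∧
        (g ≤ 2 * E + 1 → 2 * x < g)) ∧
      (p ≠ min E (g - 1 - E) → 2 * x + p = E ∨ 2 * x = g + E + 1 + p) := by
  rcases le_or_gt x E with h2 | h2
  · rw [min_posDist_of_le hE h2] at h
    unfold posDist at h
    omega
  · rw [min_posDist_of_lt hx h2] at h
    unfold posDist at h
    omega

lemma cyclicConfig_of_forward {i : ZMod g} (hF : F i 1)
    (h : ∀ x < g, i + (x : ℕ) ∈ A → x ≤ (g - 1) / 2) : CyclicConfig A F :=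
  Or.inl ⟨i, hF, Or.inl h⟩

lemma cyclicConfig_of_backward {i : ZMod g} (hF : F i 1)
    (h : ∀ x < g, i + (x : ℕ) ∈ A → x = 0 ∨ g - x ≤ (g - 1) / 2) : CyclicConfig A F := by
  refine Or.inl ⟨i, hF, Or.inr fun x hx hxA => ?_⟩
  rcases Nat.eq_zero_or_pos x with rfl | h0
  · omega
  · have := h (g - x) (by omega) (by
      rwa [Nat.cast_sub hx.le, ZMod.natCast_self, zero_sub, ← sub_eq_add_neg])
    omega

lemma cyclicConfig_of_active_free {i : ZMod g} (hi : F i 1) {D p q : ℕ} (hD0 : 0 < D)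
    (hD : D < g) (hpq : p = q + posDist g 0 D)
    (h : ∀ x < g, i + (x : ℕ) ∈ A → x ≠ 0 → posDist g 0 x + p = posDist g D x + q) :
    CyclicConfig A F := by
  unfold posDist at *
  rcases le_total (2 * D) g with h2 | h2
  · refine cyclicConfig_of_backward hi fun x hx hxA => ?_
    have := h x hx hxA
    omega
  · refine cyclicConfig_of_forward hi fun x hx hxA => ?_
    have := h x hx hxA
    omega

lemma cyclicConfig_of_cycle_leg {j : ZMod g} {E p : ℕ} (hE : E < g) (hp : min E (g - 1 - E) = p)
    (hj : F j 1)
    (h : ∀ x < g, j + (x : ℕ) ∈ A → x ≠ 0 →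
      min (posDist g E x) (posDist g (E + 1) x) = posDist g 0 x + p) : CyclicConfig A F := by
  rcases le_total (2 * E + 1) g with h2 | h2
  · refine cyclicConfig_of_backward hj fun x hx hxA => ?_
    have h1 := fun h0 => (cycle_edge_solutions hE hx h0 (h x hx hxA h0)).2.1 hp.symm
    omega
  · refine cyclicConfig_of_forward hj fun x hx hxA => ?_
    have h1 := fun h0 => (cycle_edge_solutions hE hx h0 (h x hx hxA h0)).2.1 hp.symm
    omega

variable [NeZero g]


lemma cycDist_natCast_sub {a b : ℕ} (ha : a ≤ g) (hb : b ≤ g) :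
    cycDist ((a : ZMod g) - (b : ZMod g)) = posDist g a b := by
  have key : ∀ n ≤ g, cycDist (n : ZMod g) = min n (g - n) := by
    intro n hn
    unfold cycDist
    rcases hn.lt_or_eq with h | rfl
    · rw [ZMod.val_natCast_of_lt h]
    · simp
  unfold posDist
  rcases le_total a b with h | h
  · rw [cycDist_sub_comm, ← Nat.cast_sub h, key _ (by omega)]
    congr 1 <;> omega
  · rw [← Nat.cast_sub h, key _ (by omega)]
    congr 1 <;> omega

lemma exists_eq_add_natCast (i m : ZMod g) : ∃ x < g, m = i + (x : ℕ) :=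
  ⟨(m - i).val, ZMod.val_lt _, by rw [ZMod.natCast_zmod_val]; ring⟩

lemma exists_two_positions (hA : ∃ m ∈ A, ∃ m' ∈ A, m ≠ m') (i : ZMod g) :
    ∃ x < g, ∃ y < g, x ≠ y ∧ i + (x : ℕ) ∈ A ∧ i + (y : ℕ) ∈ A := by
  obtain ⟨m, hm, m', hm', hne⟩ := hA
  obtain ⟨x, hx, rfl⟩ := exists_eq_add_natCast i m
  obtain ⟨y, hy, rfl⟩ := exists_eq_add_natCast i m'
  exact ⟨x, hx, y, hy, fun h => hne (by rw [h]), hm, hm'⟩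

/-- Two free trees containing undistinguished edges. -/
lemma cyclicConfig_of_two_free (hF : ∀ i n n', n' ≤ n → F i n → F i n')
    (hA : ∃ m ∈ A, ∃ m' ∈ A, m ≠ m') {i : ZMod g} {D p q : ℕ} (hD0 : 0 < D) (hD : 2 * D ≤ g)
    (hi : F i (p + 1)) (hj : F (i + (D : ℕ)) (q + 1)) (hiA : i ∉ A) (hjA : i + (D : ℕ) ∉ A)
    (h : ∀ x < g, i + (x : ℕ) ∈ A → posDist g 0 x + p = posDist g D x + q) :
    CyclicConfig A F := by
  have hpos : ∀ x < g, i + (x : ℕ) ∈ A → x ≠ 0 ∧ x ≠ D := by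
    intro x _ hxA
    exact ⟨fun h => hiA (by simpa [h] using hxA), fun h => hjA (h ▸ hxA)⟩
  unfold posDist at h
  rcases lt_trichotomy q (p + D) with hq | hq | hq
  · rcases lt_trichotomy p (q + D) with hp | hp | hp
    · have hval : ∀ x < g, i + (x : ℕ) ∈ A →
          2 * x + p = D + q ∨ 2 * x + q = g + D + p := by
        intro x hx hxA
        have h1 := h x hx hxA
        have h2 := hpos x hx hxA
        omega
      obtain ⟨x, hx, y, hy, hxy, hxA, hyA⟩ := exists_two_positions hA i
      wlog hlt : x < y generalizing x y
      · exact this y hy x hx hxy.symm hyA hxA (by omega)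
      have h1 := hval x hx hxA
      have h2 := hval y hy hyA
      have h3 : 2 * x + p = D + q := by omega
      have h4 : 2 * y + q = g + D + p := by omega
      refine Or.inr (Or.inr ?_)
      have hmem : ∀ m ∈ A, m = i + (x : ℕ) ∨ m = i + (y : ℕ) := by
        intro m hm
        obtain ⟨z, hz, rfl⟩ := exists_eq_add_natCast i m
        have := hval z hz hm
        have h5 : z = x ∨ z = y := by omega
        exact h5.imp (fun h => by rw [h]) fun h => by rw [h]
      rcases le_total p q with hpq | hpq
      · refine ⟨i + (x : ℕ), y - x, D - x, by omega, by omega, fun m hm => ?_, ?_, fun _ => ?_⟩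
        · rw [add_assoc, ← Nat.cast_add, Nat.add_sub_cancel' hlt.le]
          exact hmem m hm
        · rw [add_assoc, ← Nat.cast_add, Nat.add_sub_cancel' (by omega)]
          exact hF _ _ _ (by omega) hj
        · rw [add_assoc, ← Nat.cast_add,
            show x + (g / 2 + (y - x) - (D - x)) = g by omega, ZMod.natCast_self, add_zero]
          exact hF _ _ _ (by omega) hi
      · refine ⟨i + (y : ℕ), g - (y - x), g - y, by omega, by omega, fun m hm => ?_, ?_,
          fun _ => ?_⟩
        · rw [add_assoc, ← Nat.cast_add, show y + (g - (y - x)) = g + x by omega, Nat.cast_add,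
            ZMod.natCast_self, zero_add]
          exact (hmem m hm).symm
        · rw [add_assoc, ← Nat.cast_add, Nat.add_sub_cancel' (by omega), ZMod.natCast_self,
            add_zero]
          exact hF _ _ _ (by omega) hi
        · rw [add_assoc, ← Nat.cast_add,
            show y + (g / 2 + (g - (y - x)) - (g - y)) = g + D by omega, Nat.cast_add,
            ZMod.natCast_self, zero_add]
          exact hF _ _ _ (by omega) hj
    · refine cyclicConfig_of_backward (hF _ _ _ (by omega) hi) fun x hx hxA => ?_
      have h1 := h x hx hxA
      have h2 := hpos x hx hxA
      omega
    · exfalso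
      obtain ⟨x, hx, -, -, -, hxA, -⟩ := exists_two_positions hA i
      have h1 := h x hx hxA
      omega
  · refine cyclicConfig_of_forward (hF _ _ _ (by omega) hj) fun x hx hxA => ?_
    by_cases hw : D + x < g
    · have h1 := h (D + x) (by omega) (by rwa [Nat.cast_add, ← add_assoc])
      have h2 := hpos (D + x) (by omega) (by rwa [Nat.cast_add, ← add_assoc])
      omega
    · have e : i + ((D + x - g : ℕ) : ZMod g) ∈ A := by
        rw [Nat.cast_sub (by omega), ZMod.natCast_self, sub_zero, Nat.cast_add, ← add_assoc]
        exact hxA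
      have h1 := h _ (by omega) e
      have h2 := hpos _ (by omega) e
      omega
  · exfalso
    obtain ⟨x, hx, -, -, -, hxA, -⟩ := exists_two_positions hA i
    have h1 := h x hx hxA
    omega

/-- An active and a free tree containing undistinguished edges: the exact height difference. -/
lemma eq_add_of_active_free (hA : ∃ m ∈ A, ∃ m' ∈ A, m ≠ m') {i : ZMod g} {D p q : ℕ}
    (hD : D < g) (hpq : q + posDist g 0 D ≤ p)
    (h : ∀ x < g, i + (x : ℕ) ∈ A → x ≠ 0 → posDist g 0 x + p = posDist g D x + q) :
    p = q + posDist g 0 D := by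
  obtain ⟨x, hx, y, hy, hxy, hxA, hyA⟩ := exists_two_positions hA i
  wlog h0 : x ≠ 0 generalizing x y
  · exact this y hy x hx hxy.symm hyA hxA (by omega)
  have := h x hx hxA h0
  unfold posDist at *
  omega

lemma cyclicConfig_of_cycle_cycle (hA : ∃ m ∈ A, ∃ m' ∈ A, m ≠ m') {e f : ZMod g} (hef : e ≠ f)
    (h : ∀ m ∈ A, min (cycDist (e - m)) (cycDist (e + 1 - m)) =
      min (cycDist (f - m)) (cycDist (f + 1 - m))) : CyclicConfig A F := by
  obtain ⟨a, ha, a', ha', hne⟩ := hA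
  obtain ⟨E, hE, rfl⟩ := exists_eq_add_natCast a e
  obtain ⟨E', hE', rfl⟩ := exists_eq_add_natCast a f
  have hEE : E ≠ E' := fun h => hef (by rw [h])
  have key : ∀ x < g, a + (x : ℕ) ∈ A → min (posDist g E x) (posDist g (E + 1) x) =
      min (posDist g E' x) (posDist g (E' + 1) x) := by
    intro x hx hxA
    have h1 := h _ hxA
    rwa [add_assoc, add_assoc, add_sub_add_left_eq_sub, add_sub_add_left_eq_sub,
      add_sub_add_left_eq_sub, add_sub_add_left_eq_sub, ← Nat.cast_succ, ← Nat.cast_succ,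
      cycDist_natCast_sub hE.le hx.le, cycDist_natCast_sub hE hx.le,
      cycDist_natCast_sub hE'.le hx.le, cycDist_natCast_sub hE' hx.le] at h1
  have h0 := key 0 (Nat.pos_of_neZero g) (by simpa)
  rw [min_posDist_of_le hE (Nat.zero_le _), min_posDist_of_le hE' (Nat.zero_le _)] at h0
  have hsum : E + E' + 1 = g := by clear key h; omega
  have hall : ∀ x < g, a + (x : ℕ) ∈ A → x = 0 ∨ 2 * x = g := by
    intro x hx hxA
    have h1 := key x hx hxA
    clear key h h0
    rcases le_or_gt x E with h2 | h2 <;> rcases le_or_gt x E' with h3 | h3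
    · rw [min_posDist_of_le hE h2, min_posDist_of_le hE' h3] at h1
      omega
    · rw [min_posDist_of_le hE h2, min_posDist_of_lt hx h3] at h1
      omega
    · rw [min_posDist_of_lt hx h2, min_posDist_of_le hE' h3] at h1
      omega
    · rw [min_posDist_of_lt hx h2, min_posDist_of_lt hx h3] at h1
      omega
  obtain ⟨y, hy, rfl⟩ := exists_eq_add_natCast a a'
  have hy0 : y ≠ 0 := by rintro rfl; simp at hne
  have hy2 := (hall y hy ha').resolve_left hy0
  refine Or.inr (Or.inl ⟨⟨y, by omega⟩, a, fun m hm => ?_⟩)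
  obtain ⟨x, hx, rfl⟩ := exists_eq_add_natCast a m
  rcases hall x hx hm with rfl | h2
  · simp
  · exact Or.inr (by rw [show x = g / 2 by omega])

lemma eq_of_cycle_active (hA : ∃ m ∈ A, ∃ m' ∈ A, m ≠ m') {j : ZMod g} {E p : ℕ} (hE : E < g)
    (hle : min E (g - 1 - E) ≤ p)
    (h : ∀ x < g, j + (x : ℕ) ∈ A → x ≠ 0 →
      min (posDist g E x) (posDist g (E + 1) x) = posDist g 0 x + p) :
    min E (g - 1 - E) = p := by
  obtain ⟨x, hx, y, hy, hxy, hxA, hyA⟩ := exists_two_positions hA j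
  wlog h0 : x ≠ 0 generalizing x y
  · exact this y hy x hx hxy.symm hyA hxA (by omega)
  exact hle.antisymm (cycle_edge_solutions hE hx h0 (h x hx hxA h0)).1

lemma cyclicConfig_of_cycle_free (hF : ∀ i n n', n' ≤ n → F i n → F i n')
    (hA : ∃ m ∈ A, ∃ m' ∈ A, m ≠ m') {j : ZMod g} {E p : ℕ} (hE : E < g) (hjA : j ∉ A)
    (hj : F j (p + 1))
    (h : ∀ x < g, j + (x : ℕ) ∈ A →
      min (posDist g E x) (posDist g (E + 1) x) = posDist g 0 x + p) : CyclicConfig A F := by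
  by_cases hp : min E (g - 1 - E) = p
  · exact cyclicConfig_of_cycle_leg hE hp (hF _ _ _ (by omega) hj) fun x hx hxA _ => h x hx hxA
  have hval : ∀ z < g, j + (z : ℕ) ∈ A → 2 * z + p = E ∨ 2 * z = g + E + 1 + p := by
    intro z hz hzA
    have h0 : z ≠ 0 := fun h => hjA (by simpa [h] using hzA)
    exact (cycle_edge_solutions hE hz h0 (h z hz hzA)).2.2 (Ne.symm hp)
  obtain ⟨x, hx, y, hy, hxy, hxA, hyA⟩ := exists_two_positions hA j
  wlog hlt : x < y generalizing x y
  · exact this y hy x hx hxy.symm hyA hxA (by omega)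
  have h1 := hval x hx hxA
  have h2 := hval y hy hyA
  refine Or.inr (Or.inr ⟨j + (y : ℕ), g - (y - x), g - y, by omega, by omega, fun m hm => ?_, ?_,
    fun ⟨r, hr⟩ => by omega⟩)
  · obtain ⟨z, hz, rfl⟩ := exists_eq_add_natCast j m
    rw [add_assoc, ← Nat.cast_add, show y + (g - (y - x)) = g + x by omega, Nat.cast_add,
      ZMod.natCast_self, zero_add]
    have := hval z hz hm
    have h5 : z = y ∨ z = x := by omega
    exact h5.imp (fun h => by rw [h]) fun h => by rw [h]
  · rw [add_assoc, ← Nat.cast_add, Nat.add_sub_cancel' (by omega), ZMod.natCast_self, add_zero]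
    exact hF _ _ _ (by omega) hj

end Cyclic

namespace CycleRooting

section SameTree

variable {V : Type*} {G : SimpleGraph V} {g : ℕ} {vc : ZMod g → V} {R : CycleRooting G g vc}
  {a b c c' s : V}

lemma exists_siblings_below (hh : R.height c = R.height c') (hf : R.foot c = R.foot c')
    (hne : c ≠ c') : ∃ a b, a ≠ b ∧ 0 < R.height a ∧ R.height a = R.height b ∧
      R.parent a = R.parent b ∧ R.Below a c ∧ R.Below b c' := by
  induction hn : R.height c generalizing c c' with
  | zero =>
    refine absurd ?_ hne
    rw [← R.vc_foot c hn, hf, R.vc_foot c' (hh ▸ hn)]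
  | succ n ih =>
    have h0 : 0 < R.height c := by omega
    have h0' : 0 < R.height c' := by omega
    by_cases hp : R.parent c = R.parent c'
    · exact ⟨c, c', hne, h0, hh, hp, .refl, .refl⟩
    · have h1 := R.height_parent c h0
      have h2 := R.height_parent c' h0'
      obtain ⟨a, b, hab, ha, hhab, hpab, hac, hbc⟩ := ih (by omega)
        (by rw [R.foot_parent c h0, R.foot_parent c' h0', hf]) hp (by omega)
      exact ⟨a, b, hab, ha, hhab, hpab, .step c h0 hac, .step c' h0' hbc⟩

lemma edgeDist_lt_of_siblings (hG : G.Connected) (hab : a ≠ b) (ha : 0 < R.height a)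
    (hhab : R.height a = R.height b) (hpab : R.parent a = R.parent b) (hac : R.Below a c)
    (hbc : R.Below b c') (hh : R.height c = R.height c') (has : R.Below a s) :
    edgeDist G s s(R.parent c, c) < edgeDist G s s(R.parent c', c') := by
  have hbs : ¬ R.Below b s := by
    intro hbs
    rcases has.comparable hbs with h | h
    · exact hab (h.eq_of_height_le hhab.ge).symm
    · exact hab (h.eq_of_height_le hhab.le)
  have hsp : G.dist s (R.parent a) = G.dist s a + 1 := by
    rw [dist_below hG ha has (not_below_parent ha), SimpleGraph.dist_self]
  have upper : ∀ x, R.Below a x → G.dist s x + R.height a ≤ G.dist s a + R.height x := by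
    intro x hx
    have h1 := hx.dist_add_height_le hG
    have h2 := hG.dist_triangle (u := s) (v := a) (w := x)
    rw [SimpleGraph.dist_comm] at h1
    omega
  have lower : ∀ x, R.Below b x → G.dist s a + 2 + R.height x ≤ G.dist s x + R.height a := by
    intro x hx
    have h1 := dist_below hG (hhab ▸ ha) hx hbs
    have h2 := R.height_sub_le_dist hG b x
    rw [← hpab, SimpleGraph.dist_comm (v := s) , SimpleGraph.dist_comm (u := R.parent a), hsp,
      SimpleGraph.dist_comm (u := x)] at h1
    omega
  have hc0 := hac.height_le
  have h1 := R.height_parent c (by omega)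
  have h2 := R.height_parent c' (by omega)
  have u1 := upper c hac
  have l1 := lower c' hbc
  simp only [edgeDist_mk]
  by_cases hca : c = a
  · have hcb : c' = b := hbc.eq_of_height_le (by rw [← hh, hca, hhab])
    subst hca hcb
    rw [← hpab, hsp]
    omega
  · have hcb : c' ≠ b := fun h => hca (hac.eq_of_height_le (by rw [hh, h, hhab]))
    have u2 := upper _ (hac.parent_of_ne hca).2
    have l2 := lower _ (hbc.parent_of_ne hcb).2
    omega

end SameTree

variable {V : Type*} [Fintype V] {G : SimpleGraph V} [DecidableRel G.Adj] {g : ℕ}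
  {vc : ZMod g → V} {R : CycleRooting G g vc} {a b c c' s : V} {S : Set V}

variable (R) in
/-- A thread free of `S`, hanging at the cycle vertex `vc i`, reaches height `n`. -/
def FreeLeg (S : Set V) (i : ZMod g) (n : ℕ) : Prop :=
  ∃ a, R.Leg a ∧ R.parent a = vc i ∧ (∀ s ∈ S, ¬ R.Below a s) ∧ ∃ c, R.Below a c ∧ n ≤ R.height c

lemma FreeLeg.mono {i : ZMod g} {n n' : ℕ} (h : n' ≤ n) : R.FreeLeg S i n → R.FreeLeg S i n' :=
  fun ⟨a, ha, hp, hf, c, hc, hn⟩ => ⟨a, ha, hp, hf, c, hc, h.trans hn⟩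

variable (R) in
/-- The positions of the cycle vertices whose trees meet `S`. -/
def activeFeet (S : Set V) : Set (ZMod g) := {m | ∃ s ∈ S, R.foot s = m}

lemma freeLeg_of_le_edgeDist (hG : G.Connected) (hg : 3 ≤ g) (hS : BranchResolving G S)
    (hc : 0 < R.height c)
    (h : ∀ s ∈ S, R.foot s = R.foot c →
      R.height s + (R.height c - 1) ≤ edgeDist G s s(R.parent c, c)) :
    R.FreeLeg S (R.foot c) (R.height c) := by
  obtain ⟨a, ha, hpa, hac⟩ := exists_below_height_one hc
  have hfree : ∀ s ∈ S, ¬ R.Below a s := by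
    intro s hs has
    have h1 := h s hs (has.foot_eq.trans hac.foot_eq.symm)
    have h2 := edgeDist_tree_lt hG (by omega) has hac
    omega
  exact ⟨a, leg_of_free hg hS (by omega) hfree, hpa, hfree, c, hac, le_rfl⟩

lemma false_of_same_foot (hG : G.Connected) (hg : 3 ≤ g) (hS : BranchResolving G S)
    (hA : ∃ m ∈ R.activeFeet S, ∃ m' ∈ R.activeFeet S, m ≠ m') (hc : 0 < R.height c)
    (hc' : 0 < R.height c') (hne : c ≠ c') (hf : R.foot c = R.foot c')
    (h : ∀ s ∈ S, edgeDist G s s(R.parent c, c) = edgeDist G s s(R.parent c', c')) : False := by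
  obtain ⟨s, hs, hsf⟩ : ∃ s ∈ S, R.foot s ≠ R.foot c := by
    obtain ⟨_, ⟨s, hs, rfl⟩, _, ⟨s', hs', rfl⟩, hss⟩ := hA
    by_cases h1 : R.foot s = R.foot c
    · exact ⟨s', hs', fun h2 => hss (h1.trans h2.symm)⟩
    · exact ⟨s, hs, h1⟩
  have hh : R.height c = R.height c' := by
    have h1 := h s hs
    rw [edgeDist_tree_of_foot_ne hG (by omega) hc hsf,
      edgeDist_tree_of_foot_ne hG (by omega) hc' (hf ▸ hsf), hf] at h1
    omega
  obtain ⟨a, b, hab, ha, hhab, hpab, hac, hbc⟩ := exists_siblings_below hh hf hne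
  have hfa : ∀ s ∈ S, ¬ R.Below a s := fun s hs has =>
    (edgeDist_lt_of_siblings hG hab ha hhab hpab hac hbc hh has).ne (h s hs)
  have hfb : ∀ s ∈ S, ¬ R.Below b s := fun s hs hbs =>
    (edgeDist_lt_of_siblings hG hab.symm (hhab ▸ ha) hhab.symm hpab.symm hbc hac hh.symm hbs).ne'
      (h s hs)
  exact not_two_free_legs hg hS (leg_of_free hg hS ha hfa) (leg_of_free hg hS (hhab ▸ ha) hfb)
    hab hpab hfa hfb

lemma cycDist_add_sub_add [NeZero g] (i : ZMod g) {a b : ℕ} (ha : a ≤ g) (hb : b ≤ g) :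
    cycDist (i + (a : ZMod g) - (i + (b : ZMod g))) = posDist g a b := by
  rw [add_sub_add_left_eq_sub, cycDist_natCast_sub ha hb]

lemma cyclicConfig_of_tree_tree (hG : G.Connected) (hg : 3 ≤ g) (hS : BranchResolving G S)
    (hA : ∃ m ∈ R.activeFeet S, ∃ m' ∈ R.activeFeet S, m ≠ m') (hc : 0 < R.height c)
    (hc' : 0 < R.height c') (hne : R.foot c ≠ R.foot c')
    (h : ∀ s ∈ S, edgeDist G s s(R.parent c, c) = edgeDist G s s(R.parent c', c')) :
    CyclicConfig (R.activeFeet S) (R.FreeLeg S) := by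
  have : NeZero g := ⟨by omega⟩
  wlog hact : R.foot c' ∈ R.activeFeet S → R.foot c ∈ R.activeFeet S generalizing c c'
  · exact this hc' hc hne.symm (fun s hs => (h s hs).symm) fun _ => by tauto
  wlog hD2 : R.foot c ∉ R.activeFeet S → 2 * (R.foot c' - R.foot c).val ≤ g generalizing c c'
  · have h1 : R.foot c ∉ R.activeFeet S := by tauto
    refine this hc' hc hne.symm (fun s hs => (h s hs).symm) (fun h => absurd h h1) fun _ => ?_
    have h2 : (R.foot c - R.foot c').val = g - (R.foot c' - R.foot c).val := by
      rw [← neg_sub, ZMod.neg_val, if_neg (sub_ne_zero.2 hne.symm)]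
    have h3 := ZMod.val_lt (R.foot c' - R.foot c)
    have h4 : ¬ 2 * (R.foot c' - R.foot c).val ≤ g := by tauto
    omega
  obtain ⟨D, hD, hDc⟩ := exists_eq_add_natCast (R.foot c) (R.foot c')
  have hval : (R.foot c' - R.foot c).val = D := by
    rw [hDc, add_sub_cancel_left, ZMod.val_natCast_of_lt hD]
  rw [hval] at hD2
  have hD0 : 0 < D := Nat.pos_of_ne_zero (by rintro rfl; simp at hDc; exact hne hDc.symm)
  have hp : ∀ x < g, R.foot c + (x : ℕ) ∈ R.activeFeet S → x ≠ 0 → x ≠ D →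
      posDist g 0 x + (R.height c - 1) = posDist g D x + (R.height c' - 1) := by
    rintro x hx ⟨s, hs, hsx⟩ hx0 hxD
    have h1 := h s hs
    rw [edgeDist_tree_of_foot_ne hG (by omega) hc, edgeDist_tree_of_foot_ne hG (by omega) hc',
      hsx, hDc, cycDist_add_sub_add _ hD.le hx.le] at h1
    · have h2 := cycDist_add_sub_add (R.foot c) (Nat.zero_le g) hx.le
      rw [Nat.cast_zero, add_zero] at h2
      omega
    · rw [hsx, hDc]
      exact fun h => hxD (natCast_zmod_inj hx hD (add_left_cancel h))
    · rw [hsx]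
      exact fun h => hx0 (natCast_zmod_inj hx (by omega) (by simpa using h))
  have hdist : cycDist (R.foot c' - R.foot c) = posDist g 0 D := by
    rw [cycDist_sub_comm, hDc]
    simpa using cycDist_add_sub_add (R.foot c) (Nat.zero_le g) hD.le
  by_cases hcA : R.foot c ∈ R.activeFeet S
  · have key : ∀ s ∈ S, R.foot s = R.foot c → edgeDist G s s(R.parent c, c) =
        R.height s + posDist g 0 D + (R.height c' - 1) := by
      intro s hs hsc
      rw [h s hs, edgeDist_tree_of_foot_ne hG (by omega) hc' (hsc ▸ hne), hsc, hdist]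
    have hle : R.height c' - 1 + posDist g 0 D ≤ R.height c - 1 := by
      obtain ⟨s, hs, hsc⟩ := hcA
      have h1 := key s hs hsc
      have h2 := edgeDist_tree_le hG hc hsc
      omega
    have hc'A : R.foot c' ∉ R.activeFeet S := by
      rintro ⟨s, hs, hsc⟩
      have h1 := h s hs
      have h2 := edgeDist_tree_le hG hc' hsc
      rw [edgeDist_tree_of_foot_ne hG (by omega) hc (hsc ▸ hne.symm), hsc, cycDist_sub_comm,
        hdist] at h1
      unfold posDist at *
      omega
    have hp' : ∀ x < g, R.foot c + (x : ℕ) ∈ R.activeFeet S → x ≠ 0 →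
        posDist g 0 x + (R.height c - 1) = posDist g D x + (R.height c' - 1) :=
      fun x hx hxA hx0 => hp x hx hxA hx0 (by rintro rfl; exact hc'A (hDc ▸ hxA))
    have heq := eq_add_of_active_free hA hD hle hp'
    refine cyclicConfig_of_active_free (FreeLeg.mono hc ?_) hD0 hD heq hp'
    refine freeLeg_of_le_edgeDist hG hg hS hc fun s hs hsc => ?_
    rw [key s hs hsc]
    omega
  · have hc'A : R.foot c' ∉ R.activeFeet S := by tauto
    have free : ∀ {c}, 0 < R.height c → R.foot c ∉ R.activeFeet S →
        R.FreeLeg S (R.foot c) (R.height c - 1 + 1) := by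
      intro c hc hcA
      rw [Nat.sub_add_cancel hc]
      exact freeLeg_of_le_edgeDist hG hg hS hc fun s hs hsc => absurd ⟨s, hs, hsc⟩ hcA
    refine cyclicConfig_of_two_free (fun i n n' => FreeLeg.mono) hA hD0 (hD2 hcA) (free hc hcA)
      (hDc ▸ free hc' hc'A) hcA (hDc ▸ hc'A) fun x hx hxA => hp x hx hxA ?_ ?_
    · rintro rfl
      exact hcA (by simpa using hxA)
    · rintro rfl
      exact hc'A (hDc ▸ hxA)

lemma cyclicConfig_of_cycle_tree (hG : G.Connected) (hg : 3 ≤ g) (hS : BranchResolving G S)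
    (hA : ∃ m ∈ R.activeFeet S, ∃ m' ∈ R.activeFeet S, m ≠ m') (hc : 0 < R.height c)
    {i : ZMod g}
    (h : ∀ s ∈ S, edgeDist G s s(vc i, vc (i + 1)) = edgeDist G s s(R.parent c, c)) :
    CyclicConfig (R.activeFeet S) (R.FreeLeg S) := by
  have : NeZero g := ⟨by omega⟩
  obtain ⟨E, hE, rfl⟩ := exists_eq_add_natCast (R.foot c) i
  have hcyc : ∀ x < g, ∀ s, R.foot s = R.foot c + (x : ℕ) →
      edgeDist G s s(vc (R.foot c + (E : ℕ)), vc (R.foot c + (E : ℕ) + 1)) =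
        R.height s + min (posDist g E x) (posDist g (E + 1) x) := by
    intro x hx s hsx
    rw [R.edgeDist_cycle hG (by omega), hsx, cycDist_add_sub_add _ hE.le hx.le, add_assoc,
      ← Nat.cast_succ, cycDist_add_sub_add _ hE hx.le]
  have hp : ∀ x < g, R.foot c + (x : ℕ) ∈ R.activeFeet S → x ≠ 0 →
      min (posDist g E x) (posDist g (E + 1) x) = posDist g 0 x + (R.height c - 1) := by
    rintro x hx ⟨s, hs, hsx⟩ hx0
    have h1 := h s hs
    have h2 := cycDist_add_sub_add (R.foot c) (Nat.zero_le g) hx.le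
    rw [Nat.cast_zero, add_zero] at h2
    rw [hcyc x hx s hsx, edgeDist_tree_of_foot_ne hG (by omega) hc, hsx, h2] at h1
    · omega
    · rw [hsx]
      exact fun h => hx0 (natCast_zmod_inj hx (by omega) (by simpa using h))
  by_cases hcA : R.foot c ∈ R.activeFeet S
  · have key : ∀ s ∈ S, R.foot s = R.foot c →
        edgeDist G s s(R.parent c, c) = R.height s + min E (g - 1 - E) := by
      intro s hs hsc
      rw [← h s hs, hcyc 0 (by omega) s (by simpa), min_posDist_of_le hE (Nat.zero_le _)]
      simp
    have hle : min E (g - 1 - E) ≤ R.height c - 1 := by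
      obtain ⟨s, hs, hsc⟩ := hcA
      have h1 := key s hs hsc
      have h2 := edgeDist_tree_le hG hc hsc
      omega
    have heq := eq_of_cycle_active hA hE hle hp
    refine cyclicConfig_of_cycle_leg hE heq (FreeLeg.mono hc ?_) hp
    refine freeLeg_of_le_edgeDist hG hg hS hc fun s hs hsc => ?_
    rw [key s hs hsc, heq]
  · have hfree : R.FreeLeg S (R.foot c) (R.height c - 1 + 1) := by
      rw [Nat.sub_add_cancel hc]
      exact freeLeg_of_le_edgeDist hG hg hS hc fun s hs hsc => absurd ⟨s, hs, hsc⟩ hcA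
    refine cyclicConfig_of_cycle_free (fun i n n' => FreeLeg.mono) hA hE hcA hfree
      fun x hx hxA => hp x hx hxA ?_
    rintro rfl
    exact hcA (by simpa using hxA)

/-- A branch-resolving set with two active feet that is not an edge metric generator
produces one of the configurations. -/
theorem cyclicConfig_of_not_isEdgeMG (R : CycleRooting G g vc) (hG : G.Connected) (hg : 3 ≤ g)
    (hS : BranchResolving G S) (hA : ∃ m ∈ R.activeFeet S, ∃ m' ∈ R.activeFeet S, m ≠ m')
    (h : ¬ IsEdgeMG G S) : CyclicConfig (R.activeFeet S) (R.FreeLeg S) := by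
  have : NeZero g := ⟨by omega⟩
  unfold IsEdgeMG at h
  push Not at h
  obtain ⟨e, he, f, hf, hef, h⟩ := h
  rcases R.edge_cases he with ⟨c, hc, rfl⟩ | ⟨i, rfl⟩ <;>
    rcases R.edge_cases hf with ⟨c', hc', rfl⟩ | ⟨j, rfl⟩
  · by_cases hfoot : R.foot c = R.foot c'
    · exact (false_of_same_foot hG hg hS hA hc hc' (by rintro rfl; exact hef rfl) hfoot h).elim
    · exact cyclicConfig_of_tree_tree hG hg hS hA hc hc' hfoot h
  · exact cyclicConfig_of_cycle_tree hG hg hS hA hc fun s hs => (h s hs).symm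
  · exact cyclicConfig_of_cycle_tree hG hg hS hA hc' h
  · refine cyclicConfig_of_cycle_cycle hA (e := i) (f := j) (by rintro rfl; exact hef rfl) ?_
    rintro _ ⟨s, hs, rfl⟩
    have h1 := h s hs
    rw [R.edgeDist_cycle hG (by omega), R.edgeDist_cycle hG (by omega)] at h1
    omega

end CycleRooting

namespace CycleRooting

section Labelling

variable {V : Type*} {G : SimpleGraph V} {g : ℕ} {vc vc' : ZMod g → V}

lemma isCycleLabelling (R : CycleRooting G g vc) : IsCycleLabelling G g vc :=
  ⟨fun i j h => by rw [← R.foot_vc i, h, R.foot_vc], R.adj_vc⟩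

lemma height_eq_zero_of_mem_cycleEdges (R : CycleRooting G g vc) {x y : V}
    (h : s(x, y) ∈ cycleEdges g vc) : R.height x = 0 ∧ R.height y = 0 := by
  obtain ⟨i, hi⟩ := h
  rw [Sym2.eq_iff] at hi
  rcases hi with ⟨rfl, rfl⟩ | ⟨rfl, rfl⟩ <;> simp [R.height_vc]

lemma inTree_iff (R : CycleRooting G g vc) {i : ZMod g} {x : V} :
    inTree G g vc i x ↔ R.foot x = i := by
  constructor
  · rintro ⟨p⟩
    have key : ∀ {u w : V}, (offCycle G g vc).Walk u w → R.foot w = R.foot u := by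
      intro u w p
      induction p with
      | nil => rfl
      | @cons u v w huv _ ih =>
        rw [ih]
        rw [offCycle, deleteEdges_adj] at huv
        rcases R.adj_cases _ _ huv.1 with ⟨h, rfl⟩ | ⟨h, rfl⟩ | ⟨h0, h1, h⟩
        · exact R.foot_parent _ h
        · exact (R.foot_parent _ h).symm
        · refine absurd ?_ huv.2
          rcases h with h | h
          · exact ⟨R.foot u, by rw [R.vc_foot u h0, ← h, R.vc_foot v h1]⟩
          · exact ⟨R.foot v, by rw [R.vc_foot v h1, ← h, R.vc_foot u h0, Sym2.eq_swap]⟩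
    rw [key p, R.foot_vc]
  · rintro rfl
    have key : ∀ y, R.Below (vc (R.foot x)) y → inTree G g vc (R.foot x) y := by
      intro y hy
      induction hy with
      | refl => exact Reachable.refl _
      | step x hx _ ih =>
      refine ih.trans (Adj.reachable ?_)
      rw [offCycle, deleteEdges_adj]
      exact ⟨R.adj_parent x hx, fun h => by
        have := (R.height_eq_zero_of_mem_cycleEdges h).2
        omega⟩
    exact key x (R.below_vc_foot x)

lemma sActive_iff (R : CycleRooting G g vc) {S : Set V} {i : ZMod g} :
    SActive G g vc S i ↔ ∃ s ∈ S, R.foot s = i := by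
  simp only [SActive, R.inTree_iff]

lemma vc_foot_eq (R : CycleRooting G g vc) (R' : CycleRooting G g vc') (hG : G.Connected)
    (hr : Set.range vc' = Set.range vc) (x : V) : vc (R.foot x) = vc' (R'.foot x) := by
  obtain ⟨i, hi⟩ : vc (R.foot x) ∈ Set.range vc' := hr ▸ ⟨_, rfl⟩
  obtain ⟨j, hj⟩ : vc' (R'.foot x) ∈ Set.range vc := hr ▸ ⟨_, rfl⟩
  have h1 := R.dist_vc hG x j
  have h2 := R'.dist_vc hG x i
  have h3 := R.dist_vc hG x (R.foot x)
  have h4 := R'.dist_vc hG x (R'.foot x)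
  rw [hj] at h1
  rw [hi] at h2
  rw [SimpleGraph.dist_self] at h3 h4
  exact (hG.dist_eq_zero_iff).1 (by omega)

/-- Relabelling the cycle by a rotation, possibly composed with a reflection. -/
def affine (R : CycleRooting G g vc) (a ε : ZMod g) (hε : ε = 1 ∨ ε = -1) :
    CycleRooting G g fun i => vc (a + ε * i) where
  height := R.height
  foot x := ε * (R.foot x - a)
  parent := R.parent
  height_vc i := R.height_vc _
  foot_vc i := by rw [R.foot_vc]; rcases hε with rfl | rfl <;> ring
  vc_foot x hx := by
    rw [show a + ε * (ε * (R.foot x - a)) = R.foot x by rcases hε with rfl | rfl <;> ring,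
      R.vc_foot x hx]
  adj_parent := R.adj_parent
  height_parent := R.height_parent
  foot_parent x hx := by rw [R.foot_parent x hx]
  adj_vc i := by
    rcases hε with rfl | rfl
    · convert R.adj_vc (a + i) using 2 <;> ring
    · convert (R.adj_vc (a - (i + 1))).symm using 2 <;> ring
  adj_cases x y hxy := by
    rcases R.adj_cases x y hxy with h | h | ⟨h0, h1, h⟩
    · exact Or.inl h
    · exact Or.inr (Or.inl h)
    · refine Or.inr (Or.inr ⟨h0, h1, ?_⟩)
      rcases hε with rfl | rfl <;> rcases h with h | h <;> rw [h]
      · exact Or.inl (by ring)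
      · exact Or.inr (by ring)
      · exact Or.inr (by ring)
      · exact Or.inl (by ring)

lemma affine_below {R : CycleRooting G g vc} {a ε : ZMod g} {hε : ε = 1 ∨ ε = -1} {x y : V} :
    (R.affine a ε hε).Below x y ↔ R.Below x y := by
  constructor <;> intro h
  · induction h with
    | refl => exact .refl
    | step y hy _ ih => exact .step y hy ih
  · induction h with
    | refl => exact .refl
    | step y hy _ ih => exact .step y hy ih

lemma range_affine {a ε : ZMod g} (hε : ε = 1 ∨ ε = -1) :
    Set.range (fun i => vc (a + ε * i)) = Set.range vc := by
  ext x
  constructor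
  · rintro ⟨i, rfl⟩
    exact ⟨_, rfl⟩
  · rintro ⟨i, rfl⟩
    exact ⟨ε * (i - a), congrArg vc (by rcases hε with rfl | rfl <;> ring)⟩

lemma mem_activeFeet_affine {R : CycleRooting G g vc} {a ε : ZMod g} {hε : ε = 1 ∨ ε = -1}
    {S : Set V} {m : ZMod g} :
    m ∈ (R.affine a ε hε).activeFeet S ↔ a + ε * m ∈ R.activeFeet S := by
  refine exists_congr fun s => and_congr_right fun _ => ?_
  change ε * (R.foot s - a) = m ↔ _
  constructor
  · rintro rfl
    rcases hε with rfl | rfl <;> ring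
  · intro h
    rw [h]
    rcases hε with rfl | rfl <;> ring

lemma kOf_eq (R : CycleRooting G g vc) {S : Set V} {k : ℕ} (hk : k < g)
    (hkA : (k : ZMod g) ∈ R.activeFeet S) (hmax : ∀ x < g, (x : ZMod g) ∈ R.activeFeet S → x ≤ k) :
    kOf G g vc S = k := by
  have : IsGreatest {n : ℕ | n < g ∧ SActive G g vc S (n : ZMod g)} k :=
    ⟨⟨hk, R.sActive_iff.2 hkA⟩, fun n hn => hmax n hn.1 (R.sActive_iff.1 hn.2)⟩
  exact this.csSup_eq

lemma le_kOf (R : CycleRooting G g vc) {S : Set V} {n : ℕ} (hn : n < g)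
    (h : (n : ZMod g) ∈ R.activeFeet S) : n ≤ kOf G g vc S :=
  le_csSup ⟨g, fun _ h => h.1.le⟩ ⟨hn, R.sActive_iff.2 h⟩

lemma aS_eq_two (R : CycleRooting G g vc) {S : Set V} {k : ℕ} (hk0 : 0 < k) (hk : k < g)
    (h0 : (0 : ZMod g) ∈ R.activeFeet S) (hkA : (k : ZMod g) ∈ R.activeFeet S)
    (h : ∀ m ∈ R.activeFeet S, m = 0 ∨ m = k) : aS G g vc S = 2 := by
  have : {i : ZMod g | SActive G g vc S i} = {0, (k : ZMod g)} := by
    ext m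
    simp only [Set.mem_ofPred_eq, R.sActive_iff, Set.mem_insert_iff, Set.mem_singleton_iff]
    exact ⟨h m, by rintro (rfl | rfl) <;> assumption⟩
  rw [aS, this, Set.ncard_pair]
  intro h
  have := natCast_zmod_inj (a := 0) (b := k) (by omega) hk (by simpa using h)
  omega

end Labelling

variable {V : Type*} [Fintype V] {G : SimpleGraph V} {g : ℕ} {vc : ZMod g → V}
  {R : CycleRooting G g vc} {S : Set V}

lemma canonical_of_le_half (R : CycleRooting G g vc) (hG : IsUnicyclic G) (hg : 3 ≤ g) {k : ℕ}
    (hk : k ≤ g / 2) (h0 : (0 : ZMod g) ∈ R.activeFeet S) (hkA : (k : ZMod g) ∈ R.activeFeet S)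
    (hmax : ∀ x < g, (x : ZMod g) ∈ R.activeFeet S → x ≤ k) : Canonical G g vc S := by
  have : NeZero g := ⟨by omega⟩
  refine ⟨R.isCycleLabelling, R.sActive_iff.2 h0, fun vc' hvc' hr _ => ?_⟩
  obtain ⟨R'⟩ := exists_cycleRooting hG hg hvc'
  rw [R.kOf_eq (by omega) hkA hmax]
  have key : ∀ m ∈ R.activeFeet S, ∃ p < g, vc m = vc' (p : ZMod g) ∧ p ≤ kOf G g vc' S := by
    rintro _ ⟨s, hs, rfl⟩
    have h1 := R.vc_foot_eq R' hG.1 hr s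
    obtain ⟨p, hp, hps⟩ := exists_eq_add_natCast 0 (R'.foot s)
    rw [zero_add] at hps
    exact ⟨p, hp, by rw [h1, hps], R'.le_kOf hp ⟨s, hs, hps⟩⟩
  obtain ⟨p, hp, hvp, hpk⟩ := key 0 h0
  obtain ⟨q, hq, hvq, hqk⟩ := key k hkA
  have h1 := R.dist_vc_vc hG.1 (by omega) k 0
  have h2 := R'.dist_vc_vc hG.1 (by omega) (q : ZMod g) p
  have h3 := cycDist_natCast_sub (g := g) (a := 0) (b := k) (by omega) (by omega)
  rw [Nat.cast_zero] at h3
  rw [hvp, hvq, h2, h3, cycDist_natCast_sub hp.le hq.le] at h1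
  unfold posDist at h1
  omega

lemma two_active_affine (R : CycleRooting G g vc) (hG : IsUnicyclic G) (hg : 3 ≤ g)
    (hA : ∃ m ∈ R.activeFeet S, ∃ m' ∈ R.activeFeet S, m ≠ m') {a : ZMod g} {k : ℕ}
    (hk : k ≤ g / 2) (h : ∀ m ∈ R.activeFeet S, m = a ∨ m = a + (k : ZMod g)) :
    Canonical G g (fun i => vc (a + 1 * i)) S ∧ aS G g (fun i => vc (a + 1 * i)) S = 2 ∧
      kOf G g (fun i => vc (a + 1 * i)) S = k := by
  let R' := R.affine a 1 (Or.inl rfl)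
  have hk0 : 0 < k := by
    obtain ⟨m, hm, m', hm', hne⟩ := hA
    refine Nat.pos_of_ne_zero fun h0 => hne ?_
    have h1 := h m hm
    have h2 := h m' hm'
    simp only [h0, Nat.cast_zero, add_zero, or_self] at h1 h2
    rw [h1, h2]
  have hboth : a ∈ R.activeFeet S ∧ a + (k : ZMod g) ∈ R.activeFeet S := by
    obtain ⟨m, hm, m', hm', hne⟩ := hA
    rcases h m hm with rfl | rfl <;> rcases h m' hm' with rfl | rfl
    · exact absurd rfl hne
    · exact ⟨hm, hm'⟩
    · exact ⟨hm', hm⟩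
    · exact absurd rfl hne
  have hA' : ∀ m ∈ R'.activeFeet S, m = 0 ∨ m = k := by
    intro m hm
    rw [mem_activeFeet_affine, one_mul] at hm
    exact (h _ hm).imp (fun h => by simpa using h) fun h => by simpa using h
  have h0 : (0 : ZMod g) ∈ R'.activeFeet S := by
    rw [mem_activeFeet_affine]
    simpa using hboth.1
  have h1 : (k : ZMod g) ∈ R'.activeFeet S := by
    rw [mem_activeFeet_affine]
    simpa using hboth.2
  have hmax : ∀ x < g, (x : ZMod g) ∈ R'.activeFeet S → x ≤ k := by
    intro x hx hxA
    rcases hA' _ hxA with h | h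
    · have := natCast_zmod_inj (b := 0) hx (by omega) (by simpa using h)
      omega
    · exact (natCast_zmod_inj hx (by omega) h).le
  exact ⟨R'.canonical_of_le_half hG hg hk h0 h1 hmax,
    R'.aS_eq_two hk0 (by omega) h0 h1 hA', R'.kOf_eq (by omega) h1 hmax⟩

variable [DecidableRel G.Adj]

lemma FreeLeg.exists_thread (hg : 3 ≤ g) {i : ZMod g} {n : ℕ} (h : R.FreeLeg S i n) :
    ∃ t, IsThreadAt G (vc i) t ∧ SFree S t ∧ n ≤ t.length := by
  obtain ⟨a, ha, hp, hf, c, hc, hn⟩ := h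
  obtain ⟨t, ht, hl⟩ := ha.exists_thread
    (three_le_degree_of_child hg (by rw [hp, R.height_vc]) ha.1 rfl)
  refine ⟨t, hp ▸ ht, fun u hu hS => hf u hS ((hl.2.2.1 u).1 hu), ?_⟩
  have h1 := R.height_parent a ha.1
  rw [hp, R.height_vc] at h1
  have h2 := hc.height_le
  have := (hl.2.2.2 (R.height c - R.height a)).1 ⟨c, (hl.2.2.1 c).2 hc, by omega⟩
  omega

lemma freeLeg_affine {a ε : ZMod g} {hε : ε = 1 ∨ ε = -1} {i : ZMod g} {n : ℕ} :
    (R.affine a ε hε).FreeLeg S i n ↔ R.FreeLeg S (a + ε * i) n := by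
  simp only [FreeLeg, Leg, affine_below]
  rfl

lemma containsD_of_halfArc (R : CycleRooting G g vc) (hG : IsUnicyclic G) (hg : 3 ≤ g)
    (hA : ∃ m ∈ R.activeFeet S, ∃ m' ∈ R.activeFeet S, m ≠ m') {i ε : ZMod g}
    (hε : ε = 1 ∨ ε = -1) (hi : R.FreeLeg S i 1)
    (h : ∀ x < g, i + ε * (x : ℕ) ∈ R.activeFeet S → x ≤ (g - 1) / 2) : ContainsD G g vc S := by
  classical
  have : NeZero g := ⟨by omega⟩
  let X := (Finset.range g).filter fun x : ℕ => i + ε * (x : ZMod g) ∈ R.activeFeet S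
  have hX : ∀ {x}, x ∈ X ↔ x < g ∧ i + ε * (x : ZMod g) ∈ R.activeFeet S := by simp [X]
  have hpos : ∀ m ∈ R.activeFeet S, ∃ x ∈ X, m = i + ε * (x : ZMod g) := by
    intro m hm
    obtain ⟨x, hx, hxm⟩ := exists_eq_add_natCast 0 (ε * (m - i))
    have e : m = i + ε * (x : ZMod g) := by
      rw [zero_add] at hxm
      rw [← hxm]
      rcases hε with rfl | rfl <;> ring
    exact ⟨x, hX.2 ⟨hx, e ▸ hm⟩, e⟩
  obtain ⟨m, hm, m', hm', hne⟩ := hA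
  obtain ⟨x, hx, rfl⟩ := hpos m hm
  have hXne : X.Nonempty := ⟨x, hx⟩
  obtain ⟨hMg, hMA⟩ := hX.1 (X.max'_mem hXne)
  obtain ⟨hmg, hmA⟩ := hX.1 (X.min'_mem hXne)
  have hmax : ∀ x ∈ X, x ≤ X.max' hXne := fun x hx => X.le_max' x hx
  have hmin : ∀ x ∈ X, X.min' hXne ≤ x := fun x hx => X.min'_le x hx
  generalize X.max' hXne = M at *
  generalize X.min' hXne = μ at *
  have hμM : μ ≤ M := hmax μ (hX.2 ⟨hmg, hmA⟩)
  have hM := h M hMg hMA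
  have hε' : -ε = 1 ∨ -ε = -1 := by rcases hε with rfl | rfl <;> simp
  let R' := R.affine (i + ε * (M : ZMod g)) (-ε) hε'
  have hR' : ∀ n ≤ M, (n : ZMod g) ∈ R'.activeFeet S ↔
      i + ε * ((M - n : ℕ) : ZMod g) ∈ R.activeFeet S := by
    intro n hn
    rw [mem_activeFeet_affine, Nat.cast_sub hn]
    ring_nf
  have h0 : (0 : ZMod g) ∈ R'.activeFeet S := by
    have := (hR' 0 (Nat.zero_le _)).2 (by simpa using hMA)
    rwa [Nat.cast_zero] at this
  have hk : ((M - μ : ℕ) : ZMod g) ∈ R'.activeFeet S :=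
    (hR' _ (Nat.sub_le _ _)).2 (by rwa [Nat.sub_sub_self hμM])
  have hkmax : ∀ n < g, (n : ZMod g) ∈ R'.activeFeet S → n ≤ M - μ := by
    intro n hn hnA
    rcases le_or_gt n M with hnM | hnM
    · have := hmin _ (hX.2 ⟨by omega, (hR' n hnM).1 hnA⟩)
      omega
    · rw [mem_activeFeet_affine] at hnA
      have e : i + ε * (M : ZMod g) + -ε * (n : ZMod g) =
          i + ε * ((g + M - n : ℕ) : ZMod g) := by
        rw [Nat.cast_sub (by omega), Nat.cast_add, ZMod.natCast_self]
        ring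
      have := hmax _ (hX.2 ⟨by omega, e ▸ hnA⟩)
      omega
  have hkOf := R'.kOf_eq (by omega) hk hkmax
  have hfree : R'.FreeLeg S (M : ZMod g) 1 := by
    rw [freeLeg_affine]
    convert hi using 1
    ring
  obtain ⟨t, ht, hf, -⟩ := hfree.exists_thread hg
  exact ⟨_, R'.isCycleLabelling, range_affine hε',
    R'.canonical_of_le_half hG hg (by omega) h0 hk hkmax, by omega, M,
    Or.inl ⟨by omega, by omega⟩, t, ht, hf⟩

theorem containsADE_of_cyclicConfig (R : CycleRooting G g vc) (hG : IsUnicyclic G) (hg : 3 ≤ g)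
    (hA : ∃ m ∈ R.activeFeet S, ∃ m' ∈ R.activeFeet S, m ≠ m')
    (h : CyclicConfig (R.activeFeet S) (R.FreeLeg S)) : ContainsADE G g vc S := by
  rcases h with ⟨i, hi, h | h⟩ | ⟨hev, a, h⟩ | ⟨a, k, i, hk, hik, h, hi, hj⟩
  · exact Or.inr (Or.inl (R.containsD_of_halfArc hG hg hA (Or.inl rfl) hi (by simpa using h)))
  · exact Or.inr (Or.inl (R.containsD_of_halfArc hG hg hA (Or.inr rfl) hi
      (by simpa [← sub_eq_add_neg] using h)))
  · obtain ⟨hcan, haS, hkOf⟩ := R.two_active_affine hG hg hA le_rfl h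
    exact Or.inl ⟨_, hcan.1, range_affine (Or.inl rfl), hcan, haS, hev, hkOf⟩
  · obtain ⟨hcan, haS, hkOf⟩ := R.two_active_affine hG hg hA hk h
    refine Or.inr (Or.inr ⟨_, hcan.1, range_affine (Or.inl rfl), hcan, haS, i, by rwa [hkOf],
      ?_, fun hev => ?_⟩)
    · rw [hkOf]
      exact FreeLeg.exists_thread (R := R.affine a 1 (Or.inl rfl)) hg
        (freeLeg_affine.2 (by rwa [one_mul]))
    · rw [hkOf]
      obtain ⟨t, ht, hf, -⟩ := FreeLeg.exists_thread (R := R.affine a 1 (Or.inl rfl)) hg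
        (freeLeg_affine.2 (by rw [one_mul]; exact hj hev))
      exact ⟨t, ht, hf⟩

end CycleRooting

namespace CycleRooting

section EdgeDist

variable {V : Type*} {G : SimpleGraph V} {g : ℕ} {vc : ZMod g → V} {R : CycleRooting G g vc}
  {a a' c s : V} {S : Set V}

lemma edgeDist_of_below_of_not_below (hG : G.Connected) (ha : 0 < R.height a) (hac : R.Below a c)
    (hs : ¬ R.Below a s) :
    edgeDist G s s(R.parent c, c) = G.dist s (R.parent a) + (R.height c - R.height a) := by
  have key : ∀ x, R.Below a x →
      G.dist s x = G.dist s (R.parent a) + 1 + (R.height x - R.height a) := by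
    intro x hx
    have h1 := dist_below hG ha hx hs
    have h2 := hx.dist_add_height_le hG
    have h3 := R.height_sub_le_dist hG a x
    rw [SimpleGraph.dist_comm (u := a)] at h3
    rw [SimpleGraph.dist_comm, h1, SimpleGraph.dist_comm (u := R.parent a)]
    omega
  have hc0 := hac.height_le
  rw [edgeDist_mk, key c hac]
  by_cases hca : c = a
  · subst hca
    omega
  · have hp := R.height_parent c (by omega)
    have hap := (hac.parent_of_ne hca).2
    rw [key _ hap]
    have := hap.height_le
    omega

lemma edgeDist_of_height_one (hG : G.Connected) (hg : 3 ≤ g) (ha : R.height a = 1)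
    (hac : R.Below a c) (hs : ¬ R.Below a s) : edgeDist G s s(R.parent c, c) =
      R.height s + cycDist (R.foot a - R.foot s) + (R.height c - 1) := by
  have hp := R.height_parent a (by omega)
  have h := R.vc_foot (R.parent a) (by omega)
  rw [R.foot_parent a (by omega)] at h
  rw [edgeDist_of_below_of_not_below hG (by omega) hac hs, ← h, R.dist_vc hG,
    R.dist_vc_vc hG (by omega), ha]

lemma tree_edge_ne_cycle_edge (hc : 0 < R.height c) (i : ZMod g) :
    s(R.parent c, c) ≠ s(vc i, vc (i + 1)) := by
  intro h
  have h1 := (R.height_eq_zero_of_mem_cycleEdges (x := R.parent c) (y := c) ⟨i, h⟩).2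
  omega

lemma not_isEdgeMG_of_antipodal (R : CycleRooting G g vc) (hG : G.Connected) (hg : 3 ≤ g)
    (hev : Even g) (hA : ∀ m ∈ R.activeFeet S, m = 0 ∨ m = (g / 2 : ℕ)) : ¬ IsEdgeMG G S := by
  have : NeZero g := ⟨by omega⟩
  intro h
  obtain ⟨r, hr⟩ := hev
  have e1 : ((g - 1 : ℕ) : ZMod g) + 1 = (g : ℕ) := by
    rw [← Nat.cast_succ, Nat.succ_eq_add_one, Nat.sub_add_cancel (by omega)]
  obtain ⟨s, hs, hne⟩ := h s(vc (0 : ℕ), vc ((0 : ℕ) + 1)) (R.adj_vc _)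
    s(vc (g - 1 : ℕ), vc ((g - 1 : ℕ) + 1)) (R.adj_vc _) (by
      intro he
      rw [Sym2.eq_iff] at he
      rcases he with ⟨he, -⟩ | ⟨-, he⟩
      · have := natCast_zmod_inj (by omega) (by omega) (R.isCycleLabelling.1 he)
        omega
      · have := natCast_zmod_inj (g := g) (a := 1) (b := g - 1) (by omega) (by omega)
          (by simpa using R.isCycleLabelling.1 he)
        omega)
  refine hne ?_
  rw [R.edgeDist_cycle hG (by omega), R.edgeDist_cycle hG (by omega), e1, ← Nat.cast_succ]
  obtain ⟨p, hp, hps, hpp⟩ : ∃ p ≤ g, R.foot s = (p : ZMod g) ∧ (p = 0 ∨ p = g / 2) := by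
    rcases hA _ ⟨s, hs, rfl⟩ with h | h
    · exact ⟨0, by omega, by simpa using h, Or.inl rfl⟩
    · exact ⟨g / 2, by omega, h, Or.inr rfl⟩
  rw [hps, cycDist_natCast_sub (by omega) hp, cycDist_natCast_sub (by omega) hp,
    cycDist_natCast_sub (by omega) hp, cycDist_natCast_sub (by omega) hp]
  unfold posDist
  omega

lemma not_isEdgeMG_of_halfArc (hG : G.Connected) (hg : 3 ≤ g) {k i : ℕ}
    (hk : k ≤ (g + 1) / 2 - 1) (hA : ∀ x < g, (x : ZMod g) ∈ R.activeFeet S → x ≤ k)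
    (hi : (k ≤ i ∧ i ≤ (g + 1) / 2 - 1) ∨ (g / 2 + k + 1 ≤ i ∧ i ≤ g - 1) ∨ i = 0)
    (ha : R.height a = 1) (hai : R.foot a = (i : ZMod g)) (hfree : ∀ s ∈ S, ¬ R.Below a s) :
    ¬ IsEdgeMG G S := by
  have : NeZero g := ⟨by omega⟩
  intro h
  have ha0 : 0 < R.height a := by omega
  have hpos : ∀ s ∈ S, ∃ p < g, R.foot s = (p : ZMod g) ∧ p ≤ k := by
    intro s hs
    obtain ⟨p, hp, hps⟩ := exists_eq_add_natCast 0 (R.foot s)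
    rw [zero_add] at hps
    exact ⟨p, hp, hps, hA p hp ⟨s, hs, hps⟩⟩
  by_cases hki : k ≤ i ∧ i ≤ (g + 1) / 2 - 1
  · obtain ⟨s, hs, hne⟩ := h s(R.parent a, a) (R.adj_parent a ha0)
      s(vc (i : ℕ), vc ((i : ℕ) + 1)) (R.adj_vc _) (tree_edge_ne_cycle_edge ha0 _)
    refine hne ?_
    obtain ⟨p, hp, hps, hpk⟩ := hpos s hs
    rw [edgeDist_of_height_one hG hg ha .refl (hfree s hs), R.edgeDist_cycle hG (by omega), hps,
      hai, ← Nat.cast_succ, cycDist_natCast_sub (by omega) hp.le,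
      cycDist_natCast_sub (by omega) hp.le]
    unfold posDist
    omega
  · obtain ⟨j, hj, hjk, hji⟩ : ∃ j, j + 1 ≤ g ∧ g / 2 + k ≤ j ∧
        (i : ZMod g) = ((j + 1 : ℕ) : ZMod g) := by
      rcases Nat.eq_zero_or_pos i with h0 | h0
      · refine ⟨g - 1, by omega, by omega, ?_⟩
        rw [Nat.sub_add_cancel (by omega), h0, ZMod.natCast_self, Nat.cast_zero]
      · exact ⟨i - 1, by omega, by omega, by rw [Nat.sub_add_cancel h0]⟩
    obtain ⟨s, hs, hne⟩ := h s(R.parent a, a) (R.adj_parent a ha0)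
      s(vc (j : ℕ), vc ((j : ℕ) + 1)) (R.adj_vc _) (tree_edge_ne_cycle_edge ha0 _)
    refine hne ?_
    obtain ⟨p, hp, hps, hpk⟩ := hpos s hs
    rw [edgeDist_of_height_one hG hg ha .refl (hfree s hs), R.edgeDist_cycle hG (by omega), hps,
      hai, hji, ← Nat.cast_succ, cycDist_natCast_sub (by omega) hp.le,
      cycDist_natCast_sub (by omega) hp.le]
    unfold posDist
    omega

lemma not_isEdgeMG_of_long_leg (hG : G.Connected) (hg : 3 ≤ g) {k i : ℕ}
    (hk : k ≤ g / 2) (hA : ∀ m ∈ R.activeFeet S, m = 0 ∨ m = (k : ZMod g)) (hi0 : 0 < i)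
    (hik : i < k) (ha : R.height a = 1) (hai : R.foot a = (i : ZMod g)) (hac : R.Below a c)
    (hc : R.height c = g / 2 - k + 1)
    (hev : Even g → ∃ a', R.height a' = 1 ∧ R.foot a' = ((g / 2 + k - i : ℕ) : ZMod g)) :
    ¬ IsEdgeMG G S := by
  have : NeZero g := ⟨by omega⟩
  intro h
  have hpos : ∀ s ∈ S, ∃ p ≤ g, R.foot s = (p : ZMod g) ∧ (p = 0 ∨ p = k) := by
    intro s hs
    rcases hA _ ⟨s, hs, rfl⟩ with h | h
    · exact ⟨0, by omega, by simpa using h, Or.inl rfl⟩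
    · exact ⟨k, by omega, h, Or.inr rfl⟩
  have hfree : ∀ {a : V} {j : ℕ}, j < g → j ≠ 0 → j ≠ k → R.foot a = (j : ZMod g) →
      ∀ s ∈ S, ¬ R.Below a s := by
    intro a j hj hj0 hjk haj s hs has
    obtain ⟨p, -, hps, hp⟩ := hpos s hs
    have := natCast_zmod_inj hj (by omega) (haj.symm.trans (has.foot_eq.symm.trans hps))
    omega
  have hfa := hfree (by omega) (by omega) (by omega) hai
  rcases Nat.even_or_odd g with he | ⟨r, hr⟩
  · obtain ⟨a', ha', haj⟩ := hev he
    obtain ⟨r, hr⟩ := he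
    have hfa' := hfree (by omega) (by omega) (by omega) haj
    obtain ⟨s, hs, hne⟩ := h s(R.parent c, c) (R.adj_parent c (by omega))
      s(R.parent a', a') (R.adj_parent a' (by omega)) (by
        intro h
        rw [Sym2.eq_iff] at h
        have hf : R.foot c = R.foot a' := by
          rcases h with ⟨-, h⟩ | ⟨h, -⟩
          · rw [h]
          · rw [← h, R.foot_parent c (by omega)]
        rw [hac.foot_eq, hai, haj] at hf
        have := natCast_zmod_inj (by omega) (by omega) hf
        omega)
    refine hne ?_
    obtain ⟨p, hp, hps, hpk⟩ := hpos s hs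
    rw [edgeDist_of_height_one hG hg ha hac (hfa s hs),
      edgeDist_of_height_one hG hg ha' .refl (hfa' s hs), hps, hai, haj, ha', hc,
      cycDist_natCast_sub (by omega) hp, cycDist_natCast_sub (by omega) hp]
    clear hev hpos hfree hA
    rcases hpk with rfl | rfl <;> (unfold posDist; omega)
  · obtain ⟨s, hs, hne⟩ := h s(R.parent c, c) (R.adj_parent c (by omega))
      s(vc (g / 2 + k - i : ℕ), vc ((g / 2 + k - i : ℕ) + 1)) (R.adj_vc _)
      (tree_edge_ne_cycle_edge (by omega) _)
    refine hne ?_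
    obtain ⟨p, hp, hps, hpk⟩ := hpos s hs
    rw [edgeDist_of_height_one hG hg ha hac (hfa s hs), R.edgeDist_cycle hG (by omega), hps,
      hai, hc, ← Nat.cast_succ, cycDist_natCast_sub (by omega) hp,
      cycDist_natCast_sub (by omega) hp, cycDist_natCast_sub (by omega) hp]
    clear hev hpos hfree hA
    rcases hpk with rfl | rfl <;> (unfold posDist; omega)

end EdgeDist

variable {V : Type*} [Fintype V] {G : SimpleGraph V} [DecidableRel G.Adj] {g : ℕ}
  {vc : ZMod g → V} {R : CycleRooting G g vc} {a b c s : V}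

lemma branchResolving_of_isEdgeMG {S : Set V} (R : CycleRooting G g vc) (hG : G.Connected)
    (hg : 3 ≤ g) (h : IsEdgeMG G S) : BranchResolving G S := by
  intro v t₁ t₂ ht₁ ht₂ hne
  obtain ⟨a, ha, hav, hat⟩ := R.exists_leg_of_isThreadAt hg ht₁
  obtain ⟨b, hb, hbv, hbt⟩ := R.exists_leg_of_isThreadAt hg ht₂
  by_contra! hfree
  have hfa : ∀ s ∈ S, ¬ R.Below a s := fun s hs has => hfree.1 s hs ((hat.2.2.1 s).2 has)
  have hfb : ∀ s ∈ S, ¬ R.Below b s := fun s hs hbs => hfree.2 s hs ((hbt.2.2.1 s).2 hbs)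
  obtain ⟨s, hs, hd⟩ := h s(R.parent a, a) (R.adj_parent a ha.1) s(R.parent b, b)
    (R.adj_parent b hb.1) (by
      rw [hav, hbv]
      intro h
      exact hne (LegList.unique (Sym2.congr_right.1 h ▸ hat) hbt))
  refine hd ?_
  rw [edgeDist_of_below_of_not_below hG ha.1 .refl (hfa s hs),
    edgeDist_of_below_of_not_below hG hb.1 .refl (hfb s hs), hav, hbv, Nat.sub_self, Nat.sub_self]

end CycleRooting

lemma not_cyclicConfig_of_three {g : ℕ} [NeZero g] {A : Set (ZMod g)} {F : ZMod g → ℕ → Prop}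
    {m : ZMod g} {k y : ℕ} (hk0 : 0 < k) (hk : k ≤ g / 2) (hky : k < y) (hyg : y < g)
    (hyk : y - k ≤ g / 2) (hgy : g - y ≤ g / 2) (hm : m ∈ A) (hmk : m + (k : ZMod g) ∈ A)
    (hmy : m + (y : ZMod g) ∈ A) : ¬ CyclicConfig A F := by
  have two : ∀ a b : ZMod g, ¬ ∀ m ∈ A, m = a ∨ m = b := by
    intro a b h
    have hne : ∀ x y : ℕ, x < y → y < g → m + (x : ZMod g) ≠ m + (y : ZMod g) := by
      intro x y hxy hy h
      have := natCast_zmod_inj (hxy.trans hy) hy (add_left_cancel h)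
      omega
    have e1 : m ≠ m + (k : ZMod g) := by
      simpa using hne 0 k hk0 (by omega)
    have e2 : m ≠ m + (y : ZMod g) := by
      simpa using hne 0 y (by omega) hyg
    have e3 := hne k y hky hyg
    rcases h _ hm with h1 | h1 <;> rcases h _ hmk with h2 | h2 <;> rcases h _ hmy with h3 | h3 <;>
      first
        | exact e1 (h1.trans h2.symm)
        | exact e2 (h1.trans h3.symm)
        | exact e3 (h2.trans h3.symm)
  rintro (⟨i, -, h | h⟩ | ⟨-, a, h⟩ | ⟨a, k, -, -, -, h, -, -⟩)
  · obtain ⟨z, hz, rfl⟩ := exists_eq_add_natCast i m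
    have h1 := h z hz hm
    have h2 := h (z + k) (by omega) (by rwa [Nat.cast_add, ← add_assoc])
    rcases lt_or_ge (z + y) g with hzy | hzy
    · have h3 := h (z + y) hzy (by rwa [Nat.cast_add, ← add_assoc])
      omega
    · have h3 := h (z + y - g) (by omega) (by
        rwa [Nat.cast_sub hzy, ZMod.natCast_self, sub_zero, Nat.cast_add, ← add_assoc])
      omega
  · obtain ⟨z, hz, hzm⟩ := exists_eq_add_natCast m i
    obtain rfl : m = i - (z : ZMod g) := by rw [hzm]; ring
    have h1 := h z hz hm
    have h2 := h (z + (g - y)) (by omega) (by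
      rw [Nat.cast_add, Nat.cast_sub hyg.le, ZMod.natCast_self]
      convert hmy using 1
      ring)
    rcases lt_or_ge z k with hzk | hzk
    · have h3 := h (z + (g - k)) (by omega) (by
        rw [Nat.cast_add, Nat.cast_sub (by omega), ZMod.natCast_self]
        convert hmk using 1
        ring)
      omega
    · have h3 := h (z - k) (by omega) (by
        rw [Nat.cast_sub hzk]
        convert hmk using 1
        ring)
      omega
  · exact two _ _ h
  · exact two _ _ h

namespace CycleRooting

variable {V : Type*} {G : SimpleGraph V} {g : ℕ} {vc : ZMod g → V}

lemma kOf_spec {S : Set V} (R : CycleRooting G g vc) (hg : 3 ≤ g)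
    (h0 : (0 : ZMod g) ∈ R.activeFeet S) (h2 : aS G g vc S = 2) :
    0 < kOf G g vc S ∧ kOf G g vc S < g ∧ (kOf G g vc S : ZMod g) ∈ R.activeFeet S ∧
      ∀ m ∈ R.activeFeet S, m = 0 ∨ m = (kOf G g vc S : ZMod g) := by
  have : NeZero g := ⟨by omega⟩
  have hmem := Nat.sSup_mem (s := {n : ℕ | n < g ∧ SActive G g vc S (n : ZMod g)})
    ⟨0, by omega, R.sActive_iff.2 (by rw [Nat.cast_zero]; exact h0)⟩ ⟨g, fun _ h => h.1.le⟩
  obtain ⟨hkg, hkA⟩ : kOf G g vc S < g ∧ SActive G g vc S (kOf G g vc S : ZMod g) := hmem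
  rw [R.sActive_iff] at hkA
  have hset : {i : ZMod g | SActive G g vc S i} = R.activeFeet S :=
    Set.ext fun i => R.sActive_iff
  rw [aS, hset] at h2
  have hk0 : 0 < kOf G g vc S := by
    obtain ⟨m, hm, hm0⟩ := Set.exists_ne_of_one_lt_ncard (by omega : 1 < (R.activeFeet S).ncard) 0
    obtain ⟨x, hx, hxm⟩ := exists_eq_add_natCast 0 m
    rw [zero_add] at hxm
    have h1 := R.le_kOf hx (hxm ▸ hm)
    have h2 : x ≠ 0 := by
      rintro rfl
      simp [hxm] at hm0
    omega
  refine ⟨hk0, hkg, hkA, fun m hm => ?_⟩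
  have hne : (0 : ZMod g) ≠ (kOf G g vc S : ZMod g) := by
    intro h
    have := natCast_zmod_inj (a := 0) (by omega) hkg (by simpa using h)
    omega
  have hsub : {(0 : ZMod g), (kOf G g vc S : ZMod g)} ⊆ R.activeFeet S := by
    rintro x (rfl | rfl) <;> assumption
  have heq := Set.eq_of_subset_of_ncard_le hsub (by rw [h2, Set.ncard_pair hne]) (Set.toFinite _)
  rw [← heq] at hm
  exact hm

lemma kOf_le_half {S : Set V} (R : CycleRooting G g vc) (hg : 3 ≤ g)
    (hcan : Canonical G g vc S) (h2 : aS G g vc S = 2) : kOf G g vc S ≤ g / 2 := by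
  have : NeZero g := ⟨by omega⟩
  obtain ⟨hk0, hkg, hkA, hA⟩ := R.kOf_spec hg (R.sActive_iff.1 hcan.2.1) h2
  generalize hk : kOf G g vc S = k at *
  let R' := R.affine (k : ZMod g) 1 (Or.inl rfl)
  have h0 : (0 : ZMod g) ∈ R'.activeFeet S := by
    rw [mem_activeFeet_affine]
    simpa using hkA
  have hk' : ((g - k : ℕ) : ZMod g) ∈ R'.activeFeet S := by
    rw [mem_activeFeet_affine, one_mul, ← Nat.cast_add, Nat.add_sub_cancel' hkg.le,
      ZMod.natCast_self]
    exact R.sActive_iff.1 hcan.2.1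
  have hmax : ∀ x < g, (x : ZMod g) ∈ R'.activeFeet S → x ≤ g - k := by
    intro x hx hxA
    rw [mem_activeFeet_affine, one_mul] at hxA
    by_contra! hlt
    have e : (k : ZMod g) + (x : ZMod g) = ((k + x - g : ℕ) : ZMod g) := by
      rw [Nat.cast_sub (by omega), ZMod.natCast_self, sub_zero, Nat.cast_add]
    rw [e] at hxA
    rcases hA _ hxA with h | h
    · have := natCast_zmod_inj (g := g) (a := k + x - g) (b := 0) (by omega) (by omega) (by simpa using h)
      omega
    · have := natCast_zmod_inj (a := k + x - g) (b := k) (by omega) hkg h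
      omega
  have h1 := hcan.2.2 _ R'.isCycleLabelling (range_affine (Or.inl rfl)) (R'.sActive_iff.2 h0)
  rw [R'.kOf_eq (by omega) hk' hmax, hk] at h1
  omega

variable [Fintype V] [DecidableRel G.Adj]

lemma exists_two_active {S : Set V} (R : CycleRooting G g vc) (hg : 3 ≤ g)
    (hb : 2 ≤ bG G g vc) (hS : BranchResolving G S) :
    ∃ m ∈ R.activeFeet S, ∃ m' ∈ R.activeFeet S, m ≠ m' := by
  have : NeZero g := ⟨by omega⟩
  obtain ⟨m, hm, m', hm', hne⟩ := (Set.one_lt_ncard (Set.toFinite _)).1 hb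
  have key : ∀ m, BranchActive G g vc m → m ∈ R.activeFeet S := by
    rintro m ⟨x, hx, hxb⟩
    obtain ⟨s, hs, hsx⟩ := R.exists_foot_eq_of_branching hg hS hxb
    exact ⟨s, hs, hsx.trans (R.inTree_iff.1 hx)⟩
  exact ⟨m, key m hm, m', key m' hm', hne⟩

/-- Adding one cycle vertex to a branch-resolving set yields an edge metric generator. -/
theorem exists_isEdgeMG_insert {S : Finset V} (R : CycleRooting G g vc) (hG : G.Connected)
    (hg : 3 ≤ g) (hb : 2 ≤ bG G g vc) (hS : BranchResolving G (S : Set V)) :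
    ∃ T : Finset V, T.card ≤ S.card + 1 ∧ IsEdgeMG G (T : Set V) := by
  classical
  have : NeZero g := ⟨by omega⟩
  obtain ⟨m, m', k, hm, hm', hmm, hk0, hk⟩ : ∃ m m' : ZMod g, ∃ k : ℕ,
      m ∈ R.activeFeet (S : Set V) ∧ m' ∈ R.activeFeet (S : Set V) ∧
        m' = m + (k : ZMod g) ∧ 0 < k ∧ k ≤ g / 2 := by
    obtain ⟨m, hm, m', hm', hne⟩ := R.exists_two_active hg hb hS
    obtain ⟨k, hk, rfl⟩ := exists_eq_add_natCast m m'
    have hk0 : 0 < k := Nat.pos_of_ne_zero (by rintro rfl; simp at hne)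
    rcases le_or_gt k (g / 2) with h | h
    · exact ⟨m, _, k, hm, hm', rfl, hk0, h⟩
    · refine ⟨_, m, g - k, hm', hm, ?_, by omega, by omega⟩
      rw [add_assoc, ← Nat.cast_add, Nat.add_sub_cancel' hk.le, ZMod.natCast_self, add_zero]
  subst hmm
  obtain ⟨y, hky, hyg, hyk, hgy⟩ : ∃ y, k < y ∧ y < g ∧ y - k ≤ g / 2 ∧ g - y ≤ g / 2 :=
    ⟨min (g / 2 + k) (g - 1), by omega, by omega, by omega, by omega⟩
  refine ⟨insert (vc (m + (y : ZMod g))) S, Finset.card_insert_le _ _, ?_⟩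
  have hsub : ∀ n ∈ R.activeFeet (S : Set V),
      n ∈ R.activeFeet ((insert (vc (m + (y : ZMod g))) S : Finset V) : Set V) :=
    fun n ⟨s, hs, hsn⟩ => ⟨s, by simp_all, hsn⟩
  have hbr : BranchResolving G ((insert (vc (m + (y : ZMod g))) S : Finset V) : Set V) := by
    intro v t₁ t₂ ht₁ ht₂ hne
    refine (hS v t₁ t₂ ht₁ ht₂ hne).imp ?_ ?_ <;>
    · rintro ⟨s, hs, hst⟩
      exact ⟨s, by simp_all, hst⟩
  by_contra hMG
  refine not_cyclicConfig_of_three (m := m) hk0 hk hky hyg hyk hgy (hsub _ hm) (hsub _ hm')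
    ⟨_, by simp, R.foot_vc _⟩
    (R.cyclicConfig_of_not_isEdgeMG hG hg hbr (R.exists_two_active hg hb hbr) hMG)

section Minimal

variable {S T : Finset V}

lemma activeFeet_eq_of_card_eq (R : CycleRooting G g vc) (hg : 3 ≤ g)
    (hS : BranchResolving G (S : Set V)) (hSc : S.card = LG G)
    (hT : BranchResolving G (T : Set V)) (hTc : T.card = LG G) :
    R.activeFeet (S : Set V) = R.activeFeet (T : Set V) := by
  ext m
  exact (exists_foot_iff_of_card_eq hg hS hSc m).trans
    (exists_foot_iff_of_card_eq hg hT hTc m).symm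

lemma exists_leg_of_thread {i : ZMod g} {t : List V} (R : CycleRooting G g vc) (hg : 3 ≤ g)
    (ht : IsThreadAt G (vc i) t) : ∃ a ∈ R.legsAt (vc i), R.LegList a t ∧ R.height a = 1 ∧
      R.foot a = i := by
  obtain ⟨a, ha, hat⟩ := R.exists_mem_legsAt_of_isThreadAt hg ht
  obtain ⟨hleg, hpa, -⟩ := mem_legsAt.1 ha
  have h1 := R.height_parent a hleg.1
  have h2 := R.foot_parent a hleg.1
  rw [hpa, R.height_vc] at h1
  rw [hpa, R.foot_vc] at h2
  exact ⟨a, ha, hat, h1.symm, h2.symm⟩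

lemma exists_free_leg_of_thread {i : ZMod g} {t : List V} (R : CycleRooting G g vc)
    (hg : 3 ≤ g) (hT : BranchResolving G (T : Set V)) (hTc : T.card = LG G)
    (ht : IsThreadAt G (vc i) t) :
    ∃ a, R.height a = 1 ∧ R.foot a = i ∧ ∀ s ∈ (T : Set V), ¬ R.Below a s := by
  obtain ⟨a, ha, -⟩ := R.exists_mem_legsAt_of_isThreadAt hg ht
  obtain ⟨b, hb, hfree⟩ := exists_free_leg_of_card_eq hg hT hTc ⟨a, ha⟩
  obtain ⟨hleg, hpb, -⟩ := mem_legsAt.1 hb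
  have h1 := R.height_parent b hleg.1
  have h2 := R.foot_parent b hleg.1
  rw [hpb, R.height_vc] at h1
  rw [hpb, R.foot_vc] at h2
  exact ⟨b, h1.symm, h2.symm, hfree⟩

/-- If one of the configurations occurs, no minimal branch-resolving set is an edge metric
generator. -/
theorem not_isEdgeMG_of_containsADE (hG : IsUnicyclic G) (hg : 3 ≤ g)
    (hS : BranchResolving G (S : Set V)) (hSc : S.card = LG G)
    (hT : BranchResolving G (T : Set V)) (hTc : T.card = LG G)
    (h : ContainsADE G g vc (S : Set V)) : ¬ IsEdgeMG G (T : Set V) := by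
  have : NeZero g := ⟨by omega⟩
  rcases h with ⟨vc', hvc, -, hcan, h2, hev, hk⟩ | ⟨vc', hvc, -, hcan, hk, i, hi, t, ht, -⟩ |
    ⟨vc', hvc, -, hcan, h2, i, hik, ⟨t, ht, htf, htl⟩, hev⟩ <;>
    obtain ⟨R⟩ := exists_cycleRooting hG hg hvc <;>
    have hST := R.activeFeet_eq_of_card_eq hg hS hSc hT hTc
  · obtain ⟨-, -, -, hA⟩ := R.kOf_spec hg (R.sActive_iff.1 hcan.2.1) h2
    rw [hST, hk] at hA
    exact R.not_isEdgeMG_of_antipodal hG.1 hg hev hA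
  · obtain ⟨a, ha, hai, hfree⟩ := R.exists_free_leg_of_thread hg hT hTc ht
    exact not_isEdgeMG_of_halfArc hG.1 hg hk (fun x hx hxA => R.le_kOf hx (hST ▸ hxA)) hi ha hai
      hfree
  · have hk2 := R.kOf_le_half hg hcan h2
    obtain ⟨hk0, hkg, hkA, hA⟩ := R.kOf_spec hg (R.sActive_iff.1 hcan.2.1) h2
    have hle : ∀ x < g, (x : ZMod g) ∈ R.activeFeet (T : Set V) → x ≤ kOf G g vc' S :=
      fun x hx hxA => R.le_kOf hx (hST ▸ hxA)
    rw [hST] at hA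
    by_cases hi : i = 0 ∨ i = kOf G g vc' (S : Set V)
    · by_cases hkg2 : kOf G g vc' (S : Set V) ≤ (g + 1) / 2 - 1
      · obtain ⟨a, ha, hai, hfree⟩ := R.exists_free_leg_of_thread hg hT hTc ht
        exact not_isEdgeMG_of_halfArc hG.1 hg hkg2 hle (by omega) ha hai hfree
      · refine R.not_isEdgeMG_of_antipodal hG.1 hg (Nat.even_iff.2 (by omega)) ?_
        rwa [show g / 2 = kOf G g vc' (S : Set V) by omega]
    · obtain ⟨a, -, hat, ha, hai⟩ := R.exists_leg_of_thread hg ht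
      obtain ⟨c, hct, hc⟩ := (hat.2.2.2 (g / 2 - kOf G g vc' (S : Set V))).2 (by omega)
      refine not_isEdgeMG_of_long_leg hG.1 hg hk2 hA (by omega) (by omega) ha hai
        ((hat.2.2.1 c).1 hct) (by omega) fun he => ?_
      obtain ⟨t', ht', -⟩ := hev he
      obtain ⟨a', -, -, ha', haj⟩ := R.exists_leg_of_thread hg ht'
      exact ⟨a', ha', haj⟩

end Minimal

end CycleRooting

lemma edgeMetricDim_le {V : Type*} {G : SimpleGraph V} {S : Finset V}
    (h : IsEdgeMG G (S : Set V)) : edgeMetricDim G ≤ S.card :=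
  Nat.sInf_le ⟨S, rfl, h⟩

lemma exists_card_eq_edgeMetricDim {V : Type*} {G : SimpleGraph V} {S : Finset V}
    (h : IsEdgeMG G (S : Set V)) :
    ∃ T : Finset V, T.card = edgeMetricDim G ∧ IsEdgeMG G (T : Set V) :=
  Nat.sInf_mem (s := {n | ∃ S : Finset V, S.card = n ∧ IsEdgeMG G ↑S}) ⟨_, S, rfl, h⟩

theorem statement_9 {V : Type*} [Fintype V] [DecidableEq V] (G : SimpleGraph V)
    [DecidableRel G.Adj] (hG : IsUnicyclic G) (g : ℕ) (hg : 3 ≤ g)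
    (vc : ZMod g → V) (hvc : IsCycleLabelling G g vc)
    (hb : 2 ≤ bG G g vc) (S : Finset V) (hS : SmallestBR G S) :
    (¬ ContainsADE G g vc ↑S → edgeMetricDim G = LG G) ∧
    (ContainsADE G g vc ↑S → edgeMetricDim G = LG G + 1) := by
  obtain ⟨R⟩ := exists_cycleRooting hG hg hvc
  have hSc := CycleRooting.SmallestBR.card_eq R hg hS
  obtain ⟨T, hTc, hT⟩ := R.exists_isEdgeMG_insert hG.1 hg hb hS.1
  obtain ⟨U, hUc, hU⟩ := exists_card_eq_edgeMetricDim hT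
  have hUbr := R.branchResolving_of_isEdgeMG hG.1 hg hU
  have hlow := R.LG_le_card hg hUbr
  have hup := edgeMetricDim_le hT
  refine ⟨fun h => ?_, fun h => ?_⟩
  · have hMG : IsEdgeMG G (S : Set V) := by
      by_contra hMG
      have hA := R.exists_two_active hg hb hS.1
      exact h (R.containsADE_of_cyclicConfig hG hg hA
        (R.cyclicConfig_of_not_isEdgeMG hG.1 hg hS.1 hA hMG))
    have := edgeMetricDim_le hMG
    omega
  · have hne : U.card ≠ LG G := fun hUL =>
      CycleRooting.not_isEdgeMG_of_containsADE hG hg hS.1 hSc hUbr hUL h hU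
    omega
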